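/- Topological Tverberg theorem: Let d ≥ 1 and let r be a prime power, and set N = (d+1)(r−1). For every continuous map f from the standard N-simplex Δ^N = {x ∈ ℝ^{N+1} : x_i ≥ 0 for all i, Σ_i x_i = 1} to ℝ^d, there exist r pairwise disjoint nonempty subsets S_1, …, S_r of {0, 1, …, N} such that the images f(F(S_1)), …, f(F(S_r)) have a point in common, where for S ⊆ {0,…,N} the face F(S) denotes {x ∈ Δ^N : x_i = 0 for all i ∉ S}. -/

import Mathlib

namespace TopTverberg

open Finset

/-! ## Ordered chains, as formal combinations of lists -/

section Chains

variable {p : ℕ} {V : Type}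

/-- Formal linear combinations of lists (the augmented complex of ordered simplices). -/
abbrev Chain (p : ℕ) (V : Type) := List V →₀ ZMod p

/-- Cone operator. -/
noncomputable def consL (p : ℕ) {V : Type} (v : V) : Chain p V →ₗ[ZMod p] Chain p V :=
  Finsupp.lmapDomain (ZMod p) (ZMod p) (List.cons v)

/-- Boundary of a list. -/
noncomputable def bdList (p : ℕ) {V : Type} : List V → Chain p V
  | [] => 0
  | v :: l => Finsupp.single l 1 - consL p v (bdList p l)

/-- Boundary operator. -/
noncomputable def bd (p : ℕ) (V : Type) : Chain p V →ₗ[ZMod p] Chain p V :=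
  Finsupp.linearCombination (ZMod p) (bdList p)

/-- Action of a self-map. -/
noncomputable def act (p : ℕ) {V : Type} (t : V → V) : Module.End (ZMod p) (Chain p V) :=
  Finsupp.lmapDomain (ZMod p) (ZMod p) (List.map t)

/-- Evaluation of a cochain. -/
noncomputable def ev (f : List V → ZMod p) : Chain p V →ₗ[ZMod p] ZMod p :=
  Finsupp.linearCombination (ZMod p) f

@[simp] lemma consL_single (v : V) (l : List V) (c : ZMod p) :
    consL p v (Finsupp.single l c) = Finsupp.single (v :: l) c := by
  simp [consL]

@[simp] lemma act_single (t : V → V) (l : List V) (c : ZMod p) :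
    act p t (Finsupp.single l c) = Finsupp.single (l.map t) c := by
  simp [act]

@[simp] lemma ev_single (f : List V → ZMod p) (l : List V) (c : ZMod p) :
    ev f (Finsupp.single l c) = c * f l := by
  simp [ev]

@[simp] lemma bd_single (l : List V) (c : ZMod p) :
    bd p V (Finsupp.single l c) = c • bdList p l := by
  simp [bd]

lemma bdList_nil : bdList p ([] : List V) = 0 := rfl

lemma bdList_cons (v : V) (l : List V) :
    bdList p (v :: l) = Finsupp.single l 1 - consL p v (bdList p l) := rfl

lemma bd_cons (v : V) (z : Chain p V) : bd p V (consL p v z) = z - consL p v (bd p V z) := by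
  induction z using Finsupp.induction_linear with
  | zero => simp
  | add x y hx hy => simp only [map_add, hx, hy]; abel
  | single l c =>
    rw [consL_single, bd_single, bd_single, bdList_cons, smul_sub, map_smul]
    simp

lemma bd_bdList (l : List V) : bd p V (bdList p l) = 0 := by
  induction l with
  | nil => simp [bdList_nil]
  | cons v l ih =>
    rw [bdList_cons, map_sub, bd_cons, ih]
    simp

lemma bd_bd (z : Chain p V) : bd p V (bd p V z) = 0 := by
  induction z using Finsupp.induction_linear with
  | zero => simp
  | add x y hx hy => simp only [map_add, hx, hy, add_zero]
  | single l c => simp [bd_bdList]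

lemma act_cons (t : V → V) (v : V) (z : Chain p V) :
    act p t (consL p v z) = consL p (t v) (act p t z) := by
  induction z using Finsupp.induction_linear with
  | zero => simp
  | add x y hx hy => simp only [map_add, hx, hy]
  | single l c => simp

lemma act_bdList (t : V → V) (l : List V) : act p t (bdList p l) = bdList p (l.map t) := by
  induction l with
  | nil => simp [bdList_nil]
  | cons v l ih => simp [bdList_cons, act_cons, ih]

lemma bd_act (t : V → V) (z : Chain p V) : bd p V (act p t z) = act p t (bd p V z) := by
  induction z using Finsupp.induction_linear with
  | zero => simp
  | add x y hx hy => simp only [map_add, hx, hy]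
  | single l c => simp [act_bdList]

lemma act_comp (s t : V → V) (z : Chain p V) : act p s (act p t z) = act p (s ∘ t) z := by
  induction z using Finsupp.induction_linear with
  | zero => simp
  | add x y hx hy => simp only [map_add, hx, hy]
  | single l c => simp

lemma act_id (z : Chain p V) : act p id z = z := by
  simp [act]

lemma act_pow (t : V → V) (s : ℕ) : act p t ^ s = act p (t^[s]) := by
  induction s with
  | zero => ext1; ext1; simp
  | succ s ih =>
    refine LinearMap.ext fun z => ?_
    rw [pow_succ', ih, Function.iterate_succ', Module.End.mul_apply, act_comp]

/-! ### Cochains -/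

/-- Cup product with a `0`-cochain. -/
def cup0 (α : V → ZMod p) (f : List V → ZMod p) : List V → ZMod p
  | [] => 0
  | v :: l => α v * f (v :: l)

/-- Cup product with a `1`-cochain. -/
def cup1 (h : V → V → ZMod p) (f : List V → ZMod p) : List V → ZMod p
  | [] => 0
  | [_] => 0
  | v :: w :: l => h v w * f (w :: l)

/-- Cup product with a `2`-cochain. -/
def cup2 (c : V → V → V → ZMod p) (f : List V → ZMod p) : List V → ZMod p
  | [] => 0
  | [_] => 0
  | [_, _] => 0
  | u :: v :: w :: l => c u v w * f (w :: l)

/-- Coboundary of a `0`-cochain. -/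
def d0 (α : V → ZMod p) (v w : V) : ZMod p := α w - α v

/-- Coboundary of a `1`-cochain. -/
def d1 (h : V → V → ZMod p) (u v w : V) : ZMod p := h v w - h u w + h u v

/-- Cocycle condition. -/
def IsCocycle (f : List V → ZMod p) : Prop := ∀ z, ev f (bd p V z) = 0

lemma ev_cup0_cons (α : V → ZMod p) (f : List V → ZMod p) (v : V) (z : Chain p V) :
    ev (cup0 α f) (consL p v z) = α v * ev f (consL p v z) := by
  induction z using Finsupp.induction_linear with
  | zero => simp
  | add x y hx hy => simp only [map_add, hx, hy]; ring
  | single l c => simp [cup0]; ring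

lemma ev_cup1_cons (h : V → V → ZMod p) (f : List V → ZMod p) (v w : V) (z : Chain p V) :
    ev (cup1 h f) (consL p v (consL p w z)) = h v w * ev f (consL p w z) := by
  induction z using Finsupp.induction_linear with
  | zero => simp
  | add x y hx hy => simp only [map_add, hx, hy]; ring
  | single l c => simp [cup1]; ring

lemma IsCocycle.cons_cons {f : List V → ZMod p} (hf : IsCocycle f) (v w : V) (l : List V) :
    ev f (consL p v (bdList p (w :: l))) = f (w :: l) := by
  have := hf (Finsupp.single (v :: w :: l) 1)
  rw [bd_single, one_smul, bdList_cons v, map_sub, sub_eq_zero] at this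
  rw [← this]; simp

lemma ev_cup0_bd {f : List V → ZMod p} (hf : IsCocycle f) (α : V → ZMod p) (z : Chain p V) :
    ev (cup0 α f) (bd p V z) = ev (cup1 (d0 α) f) z := by
  induction z using Finsupp.induction_linear with
  | zero => simp
  | add x y hx hy => simp only [map_add, hx, hy]
  | single l c =>
    rw [bd_single, map_smul, ev_single, smul_eq_mul]
    congr 1
    match l with
    | [] => simp [bdList_nil, cup1]
    | [v] => simp [bdList_nil, bdList_cons, cup1, cup0]
    | v :: w :: l =>
      rw [bdList_cons, map_sub, ev_cup0_cons, hf.cons_cons]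
      simp [cup0, cup1, d0]; ring

lemma ev_cup1_bd {f : List V → ZMod p} (hf : IsCocycle f) (h : V → V → ZMod p) (z : Chain p V) :
    ev (cup1 h f) (bd p V z) = ev (cup2 (d1 h) f) z := by
  induction z using Finsupp.induction_linear with
  | zero => simp
  | add x y hx hy => simp only [map_add, hx, hy]
  | single l c =>
    rw [bd_single, map_smul, ev_single, smul_eq_mul]
    congr 1
    match l with
    | [] => simp [bdList_nil, cup2]
    | [v] => simp [bdList_nil, bdList_cons, cup1, cup2]
    | [v, w] => simp [bdList_nil, bdList_cons, cup1, cup2]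
    | u :: v :: w :: l =>
      rw [bdList_cons, bdList_cons, map_sub, map_sub, map_sub, ev_cup1_cons, hf.cons_cons]
      simp [cup1, cup2, d1]; ring

lemma IsCocycle.cup2_d1 {f : List V → ZMod p} (hf : IsCocycle f) (h : V → V → ZMod p) :
    IsCocycle (cup2 (d1 h) f) := by
  intro z
  rw [← ev_cup1_bd hf, bd_bd, map_zero]

/-- Unit cochain. -/
def unitC (p : ℕ) {V : Type} : List V → ZMod p
  | [_] => 1
  | _ => 0

lemma unitC_cocycle : IsCocycle (unitC p : List V → ZMod p) := by
  intro z
  induction z using Finsupp.induction_linear with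
  | zero => simp
  | add x y hx hy => simp only [map_add, hx, hy, add_zero]
  | single l c =>
    rw [bd_single, map_smul, smul_eq_mul]
    match l with
    | [] => simp [bdList_nil]
    | [v] => simp [bdList_nil, bdList_cons, unitC]
    | [v, w] => simp [bdList_nil, bdList_cons, unitC]
    | u :: v :: w :: l =>
      have key : ∀ z : Chain p V, ev (unitC p) (consL p u (consL p v z)) = 0 := by
        intro z
        induction z using Finsupp.induction_linear with
        | zero => simp
        | add x y hx hy => simp only [map_add, hx, hy, add_zero]
        | single l c => simp [unitC]
      rw [bdList_cons, bdList_cons, map_sub, map_sub, map_sub, key]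
      simp [unitC]

/-- Invariance of a cochain. -/
def Inv (t : V → V) (f : List V → ZMod p) : Prop := ∀ l, f (l.map t) = f l

lemma Inv.ev {t : V → V} {f : List V → ZMod p} (hf : Inv t f) (z : Chain p V) :
    ev f (act p t z) = TopTverberg.ev f z := by
  induction z using Finsupp.induction_linear with
  | zero => simp
  | add x y hx hy => simp only [map_add, hx, hy]
  | single l c => simp [hf l]

lemma inv_unitC (t : V → V) : Inv t (unitC p : List V → ZMod p) := by
  intro l
  match l with
  | [] => rfl
  | [v] => rfl
  | v :: w :: l => rfl

lemma inv_cup0 {t : V → V} {f : List V → ZMod p} (hf : Inv t f) {α : V → ZMod p}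
    (hα : ∀ v, α (t v) = α v) : Inv t (cup0 α f) := by
  intro l
  match l with
  | [] => rfl
  | v :: l => exact congrArg₂ (· * ·) (hα v) (hf (v :: l))

lemma inv_cup1 {t : V → V} {f : List V → ZMod p} (hf : Inv t f) {h : V → V → ZMod p}
    (hh : ∀ v w, h (t v) (t w) = h v w) : Inv t (cup1 h f) := by
  intro l
  match l with
  | [] => rfl
  | [v] => rfl
  | v :: w :: l => exact congrArg₂ (· * ·) (hh v w) (hf (w :: l))

lemma inv_cup2 {t : V → V} {f : List V → ZMod p} (hf : Inv t f) {c : V → V → V → ZMod p}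
    (hc : ∀ u v w, c (t u) (t v) (t w) = c u v w) : Inv t (cup2 c f) := by
  intro l
  match l with
  | [] => rfl
  | [v] => rfl
  | [v, w] => rfl
  | u :: v :: w :: l => exact congrArg₂ (· * ·) (hc u v w) (hf (w :: l))

end Chains

/-! ## The periodic system of chains -/

section System

variable {p : ℕ} [Fact p.Prime] {V : Type} {k : ℕ}

/-- The operators of the periodic resolution. -/
noncomputable def DD (p : ℕ) {V : Type} (t : V → V) (m : ℕ) : Module.End (ZMod p) (Chain p V) :=
  if m = 0 then 0 else if Even m then ∑ s ∈ range p, act p t ^ s else act p t - 1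

/-- Koszul sign. -/
def sgn (p : ℕ) {k : ℕ} (i : Fin k) (n : Fin k → ℕ) : ZMod p := (-1) ^ (∑ j ∈ Finset.Iio i, n j)

/-- Commuting operators of order `p` with equivariant labels. -/
structure TSys (p : ℕ) (V : Type) (k : ℕ) where
  t : Fin k → V → V
  comm : ∀ i j v, t i (t j v) = t j (t i v)
  pow : ∀ i v, (t i)^[p] v = v
  a : Fin k → V → ZMod p
  a_t : ∀ i j v, a i (t j v) = a i v + if i = j then 1 else 0

lemma bd_DD (t : V → V) (m : ℕ) (z : Chain p V) : bd p V (DD p t m z) = DD p t m (bd p V z) := by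
  unfold DD
  split_ifs
  · simp
  · simp [act_pow, bd_act]
  · simp [bd_act]

lemma act_pow_p (τ : TSys p V k) (i : Fin k) : act p (τ.t i) ^ p = 1 := by
  rw [act_pow]
  have : (τ.t i)^[p] = id := funext (τ.pow i)
  rw [this]
  ext1 z; ext1; simp

lemma DD_succ_mul (τ : TSys p V k) (i : Fin k) (m : ℕ) :
    DD p (τ.t i) (m + 1) * DD p (τ.t i) m = 0 := by
  unfold DD
  rcases Nat.eq_zero_or_pos m with rfl | hm
  · simp
  rcases Nat.even_or_odd m with h | h
  · have h' : ¬ Even (m + 1) := by simpa [Nat.even_add_one] using h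
    simp only [h, h', hm.ne', Nat.succ_ne_zero, if_false, if_true]
    refine (mul_geom_sum (act p (τ.t i)) p).trans ?_
    rw [act_pow_p]; exact sub_self _
  · have h' : Even (m + 1) := by simpa [Nat.even_add_one] using h
    have h'' : ¬ Even m := by simpa using h
    simp only [h'', h', hm.ne', Nat.succ_ne_zero, if_false, if_true]
    refine (geom_sum_mul (act p (τ.t i)) p).trans ?_
    rw [act_pow_p]; exact sub_self _

lemma DD_comm (τ : TSys p V k) (i j : Fin k) (m m' : ℕ) :
    DD p (τ.t i) m * DD p (τ.t j) m' = DD p (τ.t j) m' * DD p (τ.t i) m := by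
  have hc : Commute (act p (τ.t i)) (act p (τ.t j)) := by
    refine LinearMap.ext fun z => ?_
    rw [Module.End.mul_apply, Module.End.mul_apply, act_comp, act_comp]
    congr 2
    exact funext (τ.comm i j)
  have h : ∀ (A B : Module.End (ZMod p) (Chain p V)), Commute A B →
      Commute (∑ s ∈ range p, A ^ s) B :=
    fun A B hAB => Commute.sum_left _ _ _ (fun s _ => hAB.pow_left s)
  have hs : ∀ (A B : Module.End (ZMod p) (Chain p V)), Commute A B → Commute A (B - 1) := by
    intro A B hAB
    refine LinearMap.ext fun z => ?_
    have := LinearMap.congr_fun hAB.eq z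
    simp only [Module.End.mul_apply, LinearMap.sub_apply, map_sub, Module.End.one_apply] at this ⊢
    rw [this]
  have e : Commute (DD p (τ.t i) m) (DD p (τ.t j) m') := by
    unfold DD
    split_ifs
    · exact Commute.zero_left _
    · exact Commute.zero_left _
    · exact Commute.zero_left _
    · exact Commute.zero_right _
    · exact h _ _ (h _ _ hc.symm).symm
    · exact h _ _ (hs _ _ hc)
    · exact Commute.zero_right _
    · exact (h _ _ (hs _ _ hc.symm)).symm
    · exact (hs _ _ (hs _ _ hc).symm).symm
  exact e

/-- The main relation satisfied by the chains. -/
structure ESys (τ : TSys p V k) (N : ℕ) (E : (Fin k → ℕ) → Chain p V) : Prop where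
  zero : bd p V (E 0) = Finsupp.single [] 1
  unit : ev (unitC p) (E 0) = 1
  rel : ∀ n : Fin k → ℕ, 0 < ∑ i, n i → ∑ i, n i ≤ N →
    bd p V (E n) = ∑ i, sgn p i n • DD p (τ.t i) (n i) (E (n - Pi.single i 1))

/-- Recursive construction: `Zc` is the cycle to be filled. -/
noncomputable def Zc (τ : TSys p V k) (E : (Fin k → ℕ) → Chain p V) (n : Fin k → ℕ) : Chain p V :=
  ∑ i, sgn p i n • DD p (τ.t i) (n i) (E (n - Pi.single i 1))

noncomputable def Erec (τ : TSys p V k) (x : ℕ → V) : ℕ → (Fin k → ℕ) → Chain p V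
  | 0 => fun _ => Finsupp.single [x 0] 1
  | m + 1 => fun n => consL p (x (m + 1)) (Zc τ (Erec τ x m) n)

lemma sum_sub_single (n : Fin k → ℕ) (i : Fin k) (hi : n i ≠ 0) :
    ∑ j, (n - Pi.single i 1 : Fin k → ℕ) j + 1 = ∑ j, n j := by
  classical
  have : ∀ j, n j = (n - Pi.single i 1 : Fin k → ℕ) j + (Pi.single i 1 : Fin k → ℕ) j := by
    intro j
    by_cases h : j = i
    · subst h; simp; omega
    · simp [h]
  conv_rhs => rw [Finset.sum_congr rfl (fun j _ => this j)]
  rw [Finset.sum_add_distrib]; simp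

lemma sgn_sub (n : Fin k → ℕ) (i j : Fin k) (hj : n j ≠ 0) :
    sgn p i (n - Pi.single j 1) = if j < i then - sgn p i n else sgn p i n := by
  classical
  unfold sgn
  split_ifs with h
  · have e : ∑ l ∈ Iio i, n l = ∑ l ∈ Iio i, (n - Pi.single j 1 : Fin k → ℕ) l + 1 := by
      have : ∀ l, n l = (n - Pi.single j 1 : Fin k → ℕ) l + (Pi.single j 1 : Fin k → ℕ) l := by
        intro l
        by_cases h : l = j
        · subst h; simp; omega
        · simp [h]
      rw [Finset.sum_congr rfl (fun l _ => this l), Finset.sum_add_distrib]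
      simp [Pi.single_apply, h]
    rw [e, pow_succ]; ring
  · congr 1
    apply Finset.sum_congr rfl
    intro l hl
    have : l ≠ j := by
      rintro rfl; exact h (by simpa using hl)
    simp [this]

lemma double_sum (τ : TSys p V k) (n : Fin k → ℕ) (E : (Fin k → ℕ) → Chain p V) :
    ∑ i, sgn p i n • DD p (τ.t i) (n i) (Zc τ E (n - Pi.single i 1)) = 0 := by
  classical
  unfold Zc
  simp only [map_sum, map_smul, Finset.smul_sum]
  have diag : ∀ i, DD p (τ.t i) (n i) (DD p (τ.t i) ((n - Pi.single i 1 : Fin k → ℕ) i)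
          (E (n - Pi.single i 1 - Pi.single i 1))) = 0 := by
    intro i
    rcases Nat.eq_zero_or_pos (n i) with h | h
    · simp [h, DD]
    · obtain ⟨m, hm⟩ := Nat.exists_eq_succ_of_ne_zero h.ne'
      have := DD_succ_mul τ i m
      have h2 : (n - Pi.single i 1 : Fin k → ℕ) i = m := by simp [hm]
      rw [h2, hm]
      exact LinearMap.congr_fun this _
  suffices key : ∑ x ∈ (univ : Finset (Fin k)) ×ˢ (univ : Finset (Fin k)),
      sgn p x.1 n • sgn p x.2 (n - Pi.single x.1 1) • DD p (τ.t x.1) (n x.1)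
        (DD p (τ.t x.2) ((n - Pi.single x.1 1 : Fin k → ℕ) x.2)
          (E (n - Pi.single x.1 1 - Pi.single x.2 1))) = 0 by
    rw [Finset.sum_product] at key
    exact key
  refine Finset.sum_involution (fun x _ => (x.2, x.1)) ?_ ?_ ?_ ?_
  · rintro ⟨i, j⟩ -
    simp only
    by_cases hij : i = j
    · subst hij; rw [diag]; simp
    have h1 : (n - Pi.single i 1 : Fin k → ℕ) j = n j := by simp [Ne.symm hij]
    have h2 : (n - Pi.single j 1 : Fin k → ℕ) i = n i := by simp [hij]
    rw [h1, h2]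
    by_cases hi : n i = 0
    · simp [hi, DD]
    by_cases hj : n j = 0
    · simp [hj, DD]
    have hc := LinearMap.congr_fun (DD_comm τ i j (n i) (n j)) (E (n - Pi.single i 1 - Pi.single j 1))
    simp only [Module.End.mul_apply] at hc
    rw [hc, tsub_right_comm (a := n) (b := Pi.single j 1), sgn_sub _ _ _ hi, sgn_sub _ _ _ hj,
      smul_smul, smul_smul, ← add_smul]
    rcases lt_or_gt_of_ne hij with h | h
    · simp [h, h.not_gt, mul_comm]
    · simp [h, h.not_gt, mul_comm]
  · rintro ⟨i, j⟩ - h heq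
    simp only [Prod.mk.injEq] at heq
    obtain ⟨rfl, -⟩ := heq
    apply h
    simp only
    rw [diag]; simp
  · simp
  · simp

lemma bd_Erec (τ : TSys p V k) (x : ℕ → V) (m : ℕ) (n : Fin k → ℕ) (hn : ∑ i, n i = m + 1) :
    bd p V (Erec τ x (m + 1) n) = Zc τ (Erec τ x m) n := by
  induction m generalizing n with
  | zero =>
    show bd p V (consL p _ _) = _
    rw [bd_cons]
    suffices bd p V (Zc τ (Erec τ x 0) n) = 0 by rw [this]; simp
    unfold Zc
    rw [map_sum]
    refine Finset.sum_eq_zero fun i _ => ?_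
    have hi : n i ≤ 1 := by
      have := Finset.single_le_sum (f := n) (fun _ _ => Nat.zero_le _) (mem_univ i)
      omega
    rw [map_smul, bd_DD]
    have : n i = 0 ∨ n i = 1 := by omega
    rcases this with h | h
    · simp [h, DD]
    · simp [h, DD, Erec, bdList_cons, bdList_nil]
  | succ m ih =>
    show bd p V (consL p _ _) = _
    rw [bd_cons]
    suffices bd p V (Zc τ (Erec τ x (m + 1)) n) = 0 by rw [this]; simp
    unfold Zc
    rw [map_sum, ← double_sum τ n (Erec τ x m)]
    refine Finset.sum_congr rfl fun i _ => ?_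
    rw [map_smul, bd_DD]
    by_cases hi : n i = 0
    · simp [hi, DD]
    · rw [ih]
      have := sum_sub_single n i hi
      omega

/-- The system of chains. -/
noncomputable def EE (τ : TSys p V k) (x : ℕ → V) (n : Fin k → ℕ) : Chain p V :=
  Erec τ x (∑ i, n i) n

lemma EE_sys (τ : TSys p V k) (x : ℕ → V) (N : ℕ) : ESys τ N (EE τ x) where
  zero := by simp [EE, Erec, bdList_cons, bdList_nil]
  unit := by simp [EE, Erec, unitC]
  rel := by
    intro n h0 _
    obtain ⟨m, hm⟩ := Nat.exists_eq_succ_of_ne_zero h0.ne'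
    unfold EE
    rw [hm, bd_Erec τ x m n hm]
    unfold Zc
    refine Finset.sum_congr rfl fun i _ => ?_
    by_cases hi : n i = 0
    · simp [hi, DD]
    · have := sum_sub_single n i hi
      have : ∑ j, (n - Pi.single i 1 : Fin k → ℕ) j = m := by omega
      rw [this]

end System

end TopTverberg


namespace TopTverberg

open Finset

section Eval

variable {p : ℕ} [Fact p.Prime] {V : Type} {k : ℕ}

/-- Basic `1`-cochain. -/
def al1 (τ : TSys p V k) (i : Fin k) (v w : V) : ZMod p :=
  if (τ.a i w).val < (τ.a i v).val then 1 else 0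

/-- Basic `0`-cochain. -/
def al0 (τ : TSys p V k) (i : Fin k) (v : V) : ZMod p :=
  if τ.a i v = -1 then 1 else 0

lemma val_add_one' (x : ZMod p) : (x + 1).val = if x = -1 then 0 else x.val + 1 := by
  have hp : p.Prime := Fact.out
  haveI : Fact (1 < p) := ⟨hp.one_lt⟩
  split_ifs with h
  · subst h; simp
  · have hlt : x.val + 1 < p := by
      have h1 := ZMod.val_lt x
      rcases Nat.lt_or_ge (x.val + 1) p with h2 | h2
      · exact h2
      · exfalso
        apply h
        have h3 : x.val + 1 = p := by omega
        have h4 : ((x.val + 1 : ℕ) : ZMod p) = 0 := by rw [h3]; simp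
        push_cast at h4
        rw [ZMod.natCast_zmod_val] at h4
        exact eq_neg_of_add_eq_zero_left h4
    rw [ZMod.val_add, ZMod.val_one, Nat.mod_eq_of_lt hlt]

lemma al1_t (τ : TSys p V k) (i : Fin k) (v w : V) :
    al1 τ i (τ.t i v) (τ.t i w) = al1 τ i v w + d0 (al0 τ i) v w := by
  have hp : p.Prime := Fact.out
  have hm : ∀ x : ZMod p, x ≠ -1 → x.val < (-1 : ZMod p).val := by
    intro x hx
    have h1 := val_add_one' x
    rw [if_neg hx] at h1
    have h2 := ZMod.val_lt (x + 1)
    have h3 : (-1 : ZMod p).val + 1 = p := by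
      obtain ⟨q, rfl⟩ : ∃ q, p = q + 1 := ⟨p - 1, by have := hp.pos; omega⟩
      rw [ZMod.val_neg_one]
    omega
  unfold al1 d0 al0
  simp only [τ.a_t, if_true, val_add_one']
  by_cases h1 : τ.a i w = -1 <;> by_cases h2 : τ.a i v = -1
  · simp [h1, h2]
  · have := (hm _ h2).not_gt
    simp [h1, h2, this]
  · have := (hm _ h1)
    simp [h1, h2, this]
  · simp [h1, h2]

lemma al1_t_ne (τ : TSys p V k) {i j : Fin k} (h : i ≠ j) (v w : V) :
    al1 τ i (τ.t j v) (τ.t j w) = al1 τ i v w := by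
  simp [al1, τ.a_t, h]

lemma al0_t_ne (τ : TSys p V k) {i j : Fin k} (h : i ≠ j) (v : V) :
    al0 τ i (τ.t j v) = al0 τ i v := by
  simp [al0, τ.a_t, h]

lemma d1_al1_t (τ : TSys p V k) (i j : Fin k) (u v w : V) :
    d1 (al1 τ i) (τ.t j u) (τ.t j v) (τ.t j w) = d1 (al1 τ i) u v w := by
  unfold d1
  by_cases h : i = j
  · subst h
    simp only [al1_t, d0]; ring
  · simp [al1_t_ne τ h]

lemma ev_DD_inv {t : V → V} {f : List V → ZMod p} (hf : Inv t f) (m : ℕ) (z : Chain p V) :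
    ev f (DD p t m z) = 0 := by
  have hpow : ∀ s : ℕ, ev f ((act p t ^ s) z) = ev f z := by
    intro s
    induction s with
    | zero => simp
    | succ s ih => rw [pow_succ', Module.End.mul_apply, hf.ev, ih]
  unfold DD
  split_ifs
  · simp
  · rw [LinearMap.sum_apply, map_sum, Finset.sum_congr rfl (fun s _ => hpow s)]
    simp
  · rw [LinearMap.sub_apply, map_sub, hf.ev, Module.End.one_apply, sub_self]

lemma sum_al0 (τ : TSys p V k) (i : Fin k) (v : V) :
    ∑ s ∈ range p, al0 τ i ((τ.t i)^[s] v) = 1 := by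
  have hp : p.Prime := Fact.out
  have ha : ∀ s : ℕ, τ.a i ((τ.t i)^[s] v) = τ.a i v + s := by
    intro s
    induction s with
    | zero => simp
    | succ s ih => rw [Function.iterate_succ_apply', τ.a_t, ih]; simp; ring
  simp only [al0, ha]
  rw [Finset.sum_eq_single (-1 - τ.a i v : ZMod p).val]
  · simp
  · intro b hb hne
    rw [if_neg]
    intro h
    apply hne
    have : (b : ZMod p) = -1 - τ.a i v := by rw [← h]; ring
    rw [← this, ZMod.val_natCast, Nat.mod_eq_of_lt (by simpa using hb)]
  · intro h
    exact absurd (by simpa using ZMod.val_lt _) h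

lemma iter_inv {t : V → V} {f : List V → ZMod p} (hf : Inv t f) (s : ℕ) (l : List V) :
    f (l.map (t^[s])) = f l := by
  induction s generalizing l with
  | zero => simp
  | succ s ih =>
    rw [Function.iterate_succ', ← List.map_map, hf, ih]

lemma sum_cup0 (τ : TSys p V k) (i : Fin k) {f : List V → ZMod p} (hf : Inv (τ.t i) f)
    (hf0 : f [] = 0) (y : Chain p V) :
    ∑ s ∈ range p, ev (cup0 (al0 τ i) f) ((act p (τ.t i) ^ s) y) = ev f y := by
  induction y using Finsupp.induction_linear with
  | zero => simp
  | add x y hx hy => simp only [map_add, Finset.sum_add_distrib, hx, hy]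
  | single l c =>
    simp only [act_pow, act_single, ev_single]
    rw [← Finset.mul_sum]
    congr 1
    match l with
    | [] => simp [cup0, hf0]
    | v :: l =>
      have : ∀ s, cup0 (al0 τ i) f ((v :: l).map ((τ.t i)^[s]))
          = al0 τ i ((τ.t i)^[s] v) * f (v :: l) := by
        intro s
        rw [← iter_inv hf s]
        rfl
      simp only [this]
      rw [← Finset.sum_mul, sum_al0, one_mul]

lemma ev_cup1_t (τ : TSys p V k) (i : Fin k) {f : List V → ZMod p} (hf : Inv (τ.t i) f)
    (hc : IsCocycle f) (z : Chain p V) :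
    ev (cup1 (al1 τ i) f) (act p (τ.t i) z) =
      ev (cup1 (al1 τ i) f) z + ev (cup0 (al0 τ i) f) (bd p V z) := by
  rw [ev_cup0_bd hc]
  induction z using Finsupp.induction_linear with
  | zero => simp
  | add x y hx hy => simp only [map_add, hx, hy]; ring
  | single l c =>
    rw [act_single, ev_single, ev_single, ev_single, ← mul_add]
    congr 1
    match l with
    | [] => simp [cup1]
    | [v] => simp [cup1]
    | v :: w :: l =>
      have := hf (w :: l)
      simp only [List.map_cons] at this
      simp only [List.map_cons, cup1, this, al1_t]; ring

lemma eval_al (τ : TSys p V k) {N : ℕ} {E : (Fin k → ℕ) → Chain p V} (hE : ESys τ N E)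
    {f : List V → ZMod p} (hf : ∀ i, Inv (τ.t i) f) (hc : IsCocycle f) (hf0 : f [] = 0)
    (n : Fin k → ℕ) (hn : ∀ i, Even (n i)) (hN : ∑ i, n i ≤ N) (i : Fin k) :
    ev (cup2 (d1 (al1 τ i)) f) (E n) =
      if n i = 0 then 0 else ev f (E (n - Pi.single i 1 - Pi.single i 1)) := by
  classical
  have hs : ∀ j, sgn p j n = 1 := by
    intro j
    unfold sgn
    exact (Finset.even_sum _ (fun l _ => hn l)).neg_one_pow
  rw [← ev_cup1_bd hc]
  rcases Nat.eq_zero_or_pos (∑ i, n i) with h0 | h0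
  · have : n = 0 := by
      funext j
      simpa using (Finset.sum_eq_zero_iff.1 h0) j (mem_univ j)
    subst this
    rw [hE.zero]
    simp [cup1]
  rw [hE.rel n h0 hN, map_sum, Finset.sum_eq_single i]
  rotate_left
  · intro j _ hj
    rw [map_smul, ev_DD_inv (inv_cup1 (hf j) (al1_t_ne τ hj.symm)), smul_zero]
  · simp
  rw [hs, one_smul]
  split_ifs with hi
  · simp [hi, DD]
  obtain ⟨m, hm⟩ : ∃ m, n i = m + 2 := by
    obtain ⟨a, ha⟩ := hn i
    exact ⟨n i - 2, by omega⟩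
  set z := E (n - Pi.single i 1) with hz
  set y := E (n - Pi.single i 1 - Pi.single i 1) with hy
  have hsum := sum_sub_single n i hi
  have hni : (n - Pi.single i 1 : Fin k → ℕ) i = m + 1 := by simp [hm]
  have hle : m + 1 ≤ ∑ j, (n - Pi.single i 1 : Fin k → ℕ) j := by
    rw [← hni]
    exact Finset.single_le_sum (f := (n - Pi.single i 1 : Fin k → ℕ))
      (fun _ _ => Nat.zero_le _) (mem_univ i)
  have hbz := hE.rel (n - Pi.single i 1) (by omega) (by omega)
  have hme : Even m := by
    have := hn i
    rw [hm] at this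
    simpa [Nat.even_add] using this
  have hsi : sgn p i (n - Pi.single i 1) = 1 := by
    rw [sgn_sub _ _ _ hi, if_neg (lt_irrefl i), hs]
  have hA : ∀ s : ℕ, ev (cup0 (al0 τ i) f) ((act p (τ.t i) ^ s) (bd p V z)) =
      ev (cup0 (al0 τ i) f) ((act p (τ.t i) ^ (s + 1)) y) -
      ev (cup0 (al0 τ i) f) ((act p (τ.t i) ^ s) y) := by
    intro s
    rw [hbz, map_sum, map_sum, Finset.sum_eq_single i]
    · rw [hsi, one_smul, hni]
      have hodd : ¬ Even (m + 1) := by simpa [Nat.even_add_one] using hme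
      have hD : DD p (τ.t i) (m + 1) = act p (τ.t i) - 1 := by
        simp [DD, hodd]
      rw [hD, LinearMap.sub_apply, map_sub, map_sub, Module.End.one_apply, pow_succ,
        Module.End.mul_apply]
    · intro j _ hj
      have hcm : (act p (τ.t i) ^ s) (DD p (τ.t j) ((n - Pi.single i 1 : Fin k → ℕ) j)
          (E (n - Pi.single i 1 - Pi.single j 1))) =
          DD p (τ.t j) ((n - Pi.single i 1 : Fin k → ℕ) j)
          ((act p (τ.t i) ^ s) (E (n - Pi.single i 1 - Pi.single j 1))) := by
        have hc1 : act p (τ.t i) = DD p (τ.t i) 1 + 1 := by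
          refine LinearMap.ext fun x => ?_
          simp [DD]
        have hc2 : Commute (act p (τ.t i)) (DD p (τ.t j) ((n - Pi.single i 1 : Fin k → ℕ) j)) := by
          rw [hc1]
          exact Commute.add_left (DD_comm τ i j 1 _) (Commute.one_left _)
        exact LinearMap.congr_fun (hc2.pow_left s).eq _
      rw [map_smul, map_smul, hcm, ev_DD_inv (inv_cup0 (hf j) (al0_t_ne τ hj.symm)), smul_zero]
    · simp
  have hF : ∀ s : ℕ, ev (cup1 (al1 τ i) f) ((act p (τ.t i) ^ s) z) =
      ev (cup1 (al1 τ i) f) z + (ev (cup0 (al0 τ i) f) ((act p (τ.t i) ^ s) y)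
        - ev (cup0 (al0 τ i) f) y) := by
    intro s
    induction s with
    | zero => simp
    | succ s ih =>
      have hb : bd p V ((act p (τ.t i) ^ s) z) = (act p (τ.t i) ^ s) (bd p V z) := by
        rw [act_pow, bd_act]
      rw [pow_succ', Module.End.mul_apply, ev_cup1_t τ i (hf i) hc, ih, hb, hA, pow_succ' _ s]
      ring
  have hD : DD p (τ.t i) (n i) = ∑ s ∈ range p, act p (τ.t i) ^ s := by
    simp [DD, hi, hn i]
  rw [hD, LinearMap.sum_apply, map_sum, Finset.sum_congr rfl (fun s _ => hF s),
    Finset.sum_add_distrib, Finset.sum_sub_distrib, sum_cup0 τ i (hf i) hf0]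
  simp

/-- Cocycle data attached to a character. -/
structure CData (τ : TSys p V k) where
  χ : Fin k → ZMod p
  h : V → V → ZMod p
  w : V → V → ZMod p
  w_inv : ∀ i u v, w (τ.t i u) (τ.t i v) = w u v
  eq : ∀ u v x, d1 h u v x = ∑ i, χ i * d1 (al1 τ i) u v x + d1 w u v x

/-- Iterated cup product. -/
def cupAll {τ : TSys p V k} : List (CData τ) → List V → ZMod p
  | [] => unitC p
  | c :: cs => cup2 (d1 c.h) (cupAll cs)

lemma d1_inv {τ : TSys p V k} (c : CData τ) (i : Fin k) (u v x : V) :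
    d1 c.h (τ.t i u) (τ.t i v) (τ.t i x) = d1 c.h u v x := by
  rw [c.eq, c.eq]
  simp only [d1_al1_t]
  simp [d1, c.w_inv]

lemma cupAll_props {τ : TSys p V k} (cs : List (CData τ)) :
    (∀ i, Inv (τ.t i) (cupAll cs)) ∧ IsCocycle (cupAll cs) ∧ cupAll cs [] = 0 := by
  induction cs with
  | nil => exact ⟨fun i => inv_unitC _, unitC_cocycle, rfl⟩
  | cons c cs ih =>
    exact ⟨fun i => inv_cup2 (ih.1 i) (d1_inv c i), ih.2.1.cup2_d1 _, rfl⟩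

lemma ev_cup2_lin {τ : TSys p V k} (c : CData τ) (f : List V → ZMod p) (z : Chain p V) :
    ev (cup2 (d1 c.h) f) z =
      ∑ i, c.χ i * ev (cup2 (d1 (al1 τ i)) f) z + ev (cup2 (d1 c.w) f) z := by
  induction z using Finsupp.induction_linear with
  | zero => simp
  | add x y hx hy =>
    simp only [map_add, hx, hy, mul_add, Finset.sum_add_distrib]; ring
  | single l a =>
    simp only [ev_single]
    match l with
    | [] => simp [cup2]
    | [v] => simp [cup2]
    | [v, w] => simp [cup2]
    | u :: v :: w :: l =>
      simp only [cup2, c.eq]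
      rw [add_mul, mul_add, Finset.sum_mul, Finset.mul_sum]
      congr 1
      refine Finset.sum_congr rfl fun i _ => ?_
      ring

/-- Linear form attached to a character. -/
noncomputable def linForm (χ : Fin k → ZMod p) : MvPolynomial (Fin k) (ZMod p) :=
  ∑ i, MvPolynomial.C (χ i) * MvPolynomial.X i

theorem eval_cupAll (τ : TSys p V k) {N : ℕ} {E : (Fin k → ℕ) → Chain p V} (hE : ESys τ N E)
    (cs : List (CData τ)) (n : Fin k →₀ ℕ) (hn : ∑ i, n i = cs.length) (hN : 2 * cs.length ≤ N) :
    ev (cupAll cs) (E (fun i => 2 * n i)) =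
      MvPolynomial.coeff n (cs.map (fun c => linForm c.χ)).prod := by
  classical
  induction cs generalizing n with
  | nil =>
    have h0 : n = 0 := by
      ext j
      simpa using (Finset.sum_eq_zero_iff.1 hn) j (mem_univ j)
    subst h0
    have : (fun i : Fin k => 2 * (0 : Fin k →₀ ℕ) i) = 0 := by ext; simp
    rw [this]
    simpa [cupAll] using hE.unit
  | cons c cs ih =>
    obtain ⟨h1, h2, h3⟩ := cupAll_props cs
    have hsum : ∑ i, 2 * n i = 2 * (c :: cs).length := by rw [← Finset.mul_sum, hn]
    have hlen : (c :: cs).length = cs.length + 1 := rfl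
    show ev (cup2 (d1 c.h) (cupAll cs)) _ = _
    rw [ev_cup2_lin]
    have hw : ev (cup2 (d1 c.w) (cupAll cs)) (E (fun i => 2 * n i)) = 0 := by
      rw [← ev_cup1_bd h2, hE.rel _ (by omega) (by omega), map_sum]
      refine Finset.sum_eq_zero fun i _ => ?_
      rw [map_smul, ev_DD_inv (inv_cup1 (h1 i) (c.w_inv i)), smul_zero]
    rw [hw, add_zero, List.map_cons, List.prod_cons, linForm, Finset.sum_mul,
      MvPolynomial.coeff_sum]
    refine Finset.sum_congr rfl fun i _ => ?_
    rw [eval_al τ hE h1 h2 h3 _ (by simp) (by omega), mul_assoc, MvPolynomial.coeff_C_mul,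
      MvPolynomial.coeff_X_mul']
    congr 1
    by_cases hi : n i = 0
    · simp [hi]
    · have hi' : i ∈ n.support := by simpa using hi
      rw [if_neg (by omega), if_pos hi']
      have hfun : ((fun i => 2 * n i) - Pi.single i 1 - Pi.single i 1 : Fin k → ℕ)
          = fun j => 2 * (n - Finsupp.single i 1 : Fin k →₀ ℕ) j := by
        funext j
        by_cases h : j = i
        · subst h; simp; omega
        · simp [h]
      rw [hfun, ih]
      · have := sum_sub_single (⇑n) i hi
        have e : ∀ j, (n - Finsupp.single i 1 : Fin k →₀ ℕ) j = (⇑n - Pi.single i 1 : Fin k → ℕ) j := by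
          intro j
          by_cases h : j = i
          · subst h; simp
          · simp [h]
        simp only [e]
        omega
      · omega

lemma linForm_ne_zero {χ : Fin k → ZMod p} (h : χ ≠ 0) : linForm χ ≠ 0 := by
  classical
  obtain ⟨i, hi⟩ := Function.ne_iff.1 h
  intro h0
  apply hi
  have := congrArg (MvPolynomial.eval (Pi.single i (1 : ZMod p))) h0
  simpa [linForm, Pi.single_apply] using this

lemma linForm_hom (χ : Fin k → ZMod p) : (linForm χ).IsHomogeneous 1 := by
  unfold linForm
  refine MvPolynomial.IsHomogeneous.sum _ _ _ fun i _ => ?_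
  simpa using (MvPolynomial.isHomogeneous_C (Fin k) (χ i)).mul (MvPolynomial.isHomogeneous_X _ i)

/-- Nonvanishing of the Euler class. -/
theorem exists_ne_zero (τ : TSys p V k) {N : ℕ} {E : (Fin k → ℕ) → Chain p V} (hE : ESys τ N E)
    (cs : List (CData τ)) (hcs : ∀ c ∈ cs, c.χ ≠ 0) (hN : 2 * cs.length ≤ N) :
    ∃ n : Fin k → ℕ, ∑ i, n i = 2 * cs.length ∧ ev (cupAll cs) (E n) ≠ 0 := by
  have hne : (cs.map (fun c => linForm c.χ)).prod ≠ 0 := by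
    apply List.prod_ne_zero
    intro h
    obtain ⟨c, hc, h0⟩ := List.mem_map.1 h
    exact linForm_ne_zero (hcs c hc) h0
  have hhom : (cs.map (fun c => linForm c.χ)).prod.IsHomogeneous cs.length := by
    clear hne hcs hN
    induction cs with
    | nil => simpa using MvPolynomial.isHomogeneous_one (Fin k) (ZMod p)
    | cons c cs ih =>
      rw [List.map_cons, List.prod_cons, List.length_cons, add_comm]
      exact (linForm_hom _).mul ih
  obtain ⟨n, hn⟩ := MvPolynomial.ne_zero_iff.1 hne
  have hdeg : ∑ i, n i = cs.length := by
    have := hhom hn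
    rw [Finsupp.weight_apply, Finsupp.sum_fintype] at this
    · simpa using this
    · simp
  refine ⟨fun i => 2 * n i, by rw [← Finset.mul_sum, hdeg], ?_⟩
  rw [eval_cupAll τ hE cs n hdeg hN]
  exact hn

end Eval

end TopTverberg


namespace TopTverberg

open Finset

section Subdivision

variable {p : ℕ} [Fact p.Prime] {V : Type} {k : ℕ}

/-- Barycentric subdivision operator. -/
noncomputable def subd (p : ℕ) {V : Type} (b : List V → V) : ℕ → (Chain p V →ₗ[ZMod p] Chain p V)
  | 0 => LinearMap.id
  | n + 1 => Finsupp.linearCombination (ZMod p) (fun l => consL p (b l) (subd p b n (bdList p l)))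

/-- Chains supported on a set of lists. -/
abbrev Supp (p : ℕ) {V : Type} (s : Set (List V)) : Submodule (ZMod p) (Chain p V) :=
  Finsupp.supported (ZMod p) (ZMod p) s

lemma single_mem_Supp {s : Set (List V)} {l : List V} (h : l ∈ s) (c : ZMod p) :
    (Finsupp.single l c : Chain p V) ∈ Supp p s :=
  Finsupp.single_mem_supported _ _ h

lemma map_mem_Supp {W : Type} [AddCommGroup W] [Module (ZMod p) W]
    {s : Set (List V)} {M : Submodule (ZMod p) W}
    (F : Chain p V →ₗ[ZMod p] W)
    (h : ∀ l ∈ s, F (Finsupp.single l 1) ∈ M) {z : Chain p V} (hz : z ∈ Supp p s) :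
    F z ∈ M := by
  have e : F z = ∑ l ∈ z.support, z l • F (Finsupp.single l 1) := by
    conv_lhs => rw [← Finsupp.sum_single z, Finsupp.sum, map_sum]
    refine Finset.sum_congr rfl fun l _ => ?_
    rw [← map_smul, Finsupp.smul_single, smul_eq_mul, mul_one]
  rw [e]
  exact M.sum_mem fun l hl => M.smul_mem _ (h l (hz hl))

lemma bdList_mem (l : List V) :
    bdList p l ∈ Supp p {l' | l'.length + 1 = l.length ∧ l'.Sublist l} := by
  induction l with
  | nil => simp [bdList_nil]
  | cons v l ih =>
    rw [bdList_cons]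
    refine Submodule.sub_mem _ (single_mem_Supp (by exact ⟨rfl, List.sublist_cons_self v l⟩) _) ?_
    refine map_mem_Supp (consL p v) ?_ ih
    rintro l' ⟨h1, h2⟩
    rw [consL_single]
    exact single_mem_Supp (by exact ⟨by simp [h1], h2.cons_cons v⟩) _

lemma bd_mem_len {n : ℕ} {z : Chain p V} (hz : z ∈ Supp p {l : List V | l.length = n + 1}) :
    bd p V z ∈ Supp p {l : List V | l.length = n} := by
  refine map_mem_Supp (bd p V) ?_ hz
  intro l hl
  rw [bd_single, one_smul]
  refine Finsupp.supported_mono ?_ (bdList_mem l)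
  rintro l' ⟨h, -⟩
  simp only [Set.mem_ofPred_eq] at hl ⊢
  omega

lemma subd_single (b : List V → V) (n : ℕ) (l : List V) :
    subd p b (n + 1) (Finsupp.single l 1) = consL p (b l) (subd p b n (bdList p l)) := by
  simp [subd]

lemma bd_subd (b : List V → V) (n : ℕ) {z : Chain p V}
    (hz : z ∈ Supp p {l : List V | l.length = n + 1}) :
    bd p V (subd p b (n + 1) z) = subd p b n (bd p V z) := by
  induction n generalizing z with
  | zero =>
    have : (bd p V ∘ₗ subd p b 1 - subd p b 0 ∘ₗ bd p V) z ∈ (⊥ : Submodule (ZMod p) (Chain p V)) := by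
      refine map_mem_Supp _ ?_ hz
      intro l hl
      obtain ⟨v, rfl⟩ := List.length_eq_one_iff.1 hl
      simp [subd, bdList_cons, bdList_nil]
    exact sub_eq_zero.1 (by simpa using this)
  | succ n ih =>
    have : (bd p V ∘ₗ subd p b (n + 2) - subd p b (n + 1) ∘ₗ bd p V) z
        ∈ (⊥ : Submodule (ZMod p) (Chain p V)) := by
      refine map_mem_Supp _ ?_ hz
      intro l hl
      have h1 : bdList p l ∈ Supp p {l : List V | l.length = n + 1} := by
        refine Finsupp.supported_mono ?_ (bdList_mem l)
        rintro l' ⟨h, -⟩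
        simp only [Set.mem_ofPred_eq] at hl ⊢
        omega
      rw [Submodule.mem_bot, LinearMap.sub_apply, LinearMap.comp_apply, LinearMap.comp_apply,
        subd_single, bd_cons, ih h1, bd_bdList, bd_single, one_smul]
      simp
    exact sub_eq_zero.1 (by simpa using this)

lemma subd_act (b : List V → V) (t : V → V) (hb : ∀ l, l ≠ [] → b (l.map t) = t (b l)) (n : ℕ)
    (z : Chain p V) : subd p b n (act p t z) = act p t (subd p b n z) := by
  induction n generalizing z with
  | zero => rfl
  | succ n ih =>
    induction z using Finsupp.induction_linear with
    | zero => simp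
    | add x y hx hy => simp only [map_add, hx, hy]
    | single l c =>
      have : (Finsupp.single l c : Chain p V) = c • Finsupp.single l 1 := by simp
      rw [this, map_smul, map_smul, map_smul, map_smul, act_single, subd_single, subd_single,
        act_cons, ← ih, act_bdList]
      cases l with
      | nil => simp [bdList_nil]
      | cons v l => rw [hb _ (by simp)]

lemma subd_DD (b : List V → V) (t : V → V) (hb : ∀ l, l ≠ [] → b (l.map t) = t (b l)) (n : ℕ)
    (m : ℕ) (z : Chain p V) : subd p b n (DD p t m z) = DD p t m (subd p b n z) := by
  have hpow : ∀ s z, subd p b n ((act p t ^ s) z) = (act p t ^ s) (subd p b n z) := by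
    intro s
    induction s with
    | zero => simp
    | succ s ih => intro z; rw [pow_succ, Module.End.mul_apply, ih, subd_act b t hb]; rfl
  unfold DD
  split_ifs
  · simp
  · simp [hpow]
  · simp [subd_act b t hb]

/-- The system is stable under subdivision. -/
lemma ESys.subd {τ : TSys p V k} {N : ℕ} {E : (Fin k → ℕ) → Chain p V} (hE : ESys τ N E)
    (b : List V → V) (hb : ∀ i l, l ≠ [] → b (l.map (τ.t i)) = τ.t i (b l))
    (hs : ∀ n, ∑ i, n i ≤ N → E n ∈ Supp p {l : List V | l.length = ∑ i, n i + 1}) :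
    ESys τ N (fun n => subd p b (∑ i, n i + 1) (E n)) where
  zero := by
    have := hs 0 (by simp)
    rw [bd_subd b _ this, hE.zero]
    simp [TopTverberg.subd]
  unit := by
    have h0 := hs 0 (by simp)
    have h1 := hE.unit
    have : ((ev (unitC p) ∘ₗ TopTverberg.subd p b (∑ i, (0 : Fin k → ℕ) i + 1) - ev (unitC p) :
        Chain p V →ₗ[ZMod p] ZMod p)) (E 0) ∈ (⊥ : Submodule (ZMod p) (ZMod p)) := by
      refine map_mem_Supp _ ?_ h0
      intro l hl
      simp only [Pi.zero_apply, Finset.sum_const_zero, zero_add] at hl ⊢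
      obtain ⟨v, rfl⟩ := List.length_eq_one_iff.1 hl
      simp [TopTverberg.subd, bdList_cons, bdList_nil, unitC]
    rw [Submodule.mem_bot] at this
    rw [LinearMap.sub_apply, h1, sub_eq_zero] at this
    exact this
  rel := by
    intro n h0 hN
    rw [bd_subd b _ (hs n hN), hE.rel n h0 hN, map_sum]
    refine Finset.sum_congr rfl fun i _ => ?_
    rw [map_smul, subd_DD b _ (hb i)]
    by_cases hi : n i = 0
    · simp [hi, DD]
    · rw [sum_sub_single n i hi]

end Subdivision

section Metric

variable {p : ℕ} [Fact p.Prime] {X : Type} [NormedAddCommGroup X] [NormedSpace ℝ X] {K : Set X}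

/-- Average. -/
noncomputable def avg (l : List K) : X := (l.length : ℝ)⁻¹ • (l.map Subtype.val).sum

open Classical in
/-- Barycentre with a fallback. -/
noncomputable def bary [Inhabited K] (l : List K) : K :=
  if h : avg l ∈ K then ⟨avg l, h⟩ else l.headD default

lemma avg_mem {B : Set X} (hB : Convex ℝ B) (l : List K) (h0 : l ≠ []) (h : ∀ v ∈ l, (v : X) ∈ B) :
    avg l ∈ B := by
  have hlen : (0 : ℝ) < l.length := by
    have := List.length_pos_iff.2 h0
    exact_mod_cast this
  have e : avg l = ∑ i : Fin l.length, (l.length : ℝ)⁻¹ • ((l[i] : K) : X) := by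
    unfold avg
    rw [← Finset.smul_sum]
    congr 1
    rw [← List.sum_ofFn]
    congr 1
    apply List.ext_getElem <;> simp
  rw [e]
  refine hB.sum_mem (fun _ _ => by positivity) ?_ (fun i _ => h _ (by simp))
  simp [hlen.ne']

lemma dist_avg (l : List K) (w : K) (hw : w ∈ l) {D : ℝ}
    (h : ∀ u ∈ l, ∀ v ∈ l, dist u v ≤ D) :
    dist (avg l) (w : X) ≤ ((l.length - 1 : ℕ) : ℝ) / l.length * D := by
  classical
  have hpos : 0 < l.length := List.length_pos_of_mem hw
  have hlen : (0 : ℝ) < l.length := by exact_mod_cast hpos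
  have key : ∀ l' : List K, ‖(l'.map Subtype.val).sum - (l'.length : ℝ) • (w : X)‖
      ≤ (l'.map (fun u => dist u w)).sum := by
    intro l'
    induction l' with
    | nil => simp
    | cons u l' ih =>
      have : ((u :: l').map Subtype.val).sum - ((u :: l').length : ℝ) • (w : X)
          = ((u : X) - w) + ((l'.map Subtype.val).sum - (l'.length : ℝ) • (w : X)) := by
        simp only [List.map_cons, List.sum_cons, List.length_cons]
        push_cast
        rw [add_smul, one_smul]; abel
      rw [this]
      refine (norm_add_le _ _).trans ?_
      simp only [List.map_cons, List.sum_cons]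
      gcongr
      rw [Subtype.dist_eq, dist_eq_norm]
  have h2 : (l.map (fun u => dist u w)).sum ≤ ((l.length - 1 : ℕ) : ℝ) * D := by
    have : ∀ l' : List K, (∀ u ∈ l', dist u w ≤ D) →
        (l'.map (fun u => dist u w)).sum ≤ (l'.length : ℝ) * D := by
      intro l'
      induction l' with
      | nil => simp
      | cons u l' ih =>
        intro hl
        simp only [List.map_cons, List.sum_cons, List.length_cons]
        have h1 := ih (fun v hv => hl v (List.mem_cons_of_mem _ hv))
        have h2 := hl u List.mem_cons_self
        push_cast
        linarith
    obtain ⟨s, t, rfl⟩ := List.append_of_mem hw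
    have h3 := this (s ++ t) (fun u hu => h u (by
      rcases List.mem_append.1 hu with hu | hu
      · exact List.mem_append_left _ hu
      · exact List.mem_append_right _ (List.mem_cons_of_mem _ hu)) w hw)
    have h4 : (s ++ w :: t).length - 1 = (s ++ t).length := by
      simp only [List.length_append, List.length_cons]; omega
    rw [h4]
    refine le_trans (le_of_eq ?_) h3
    simp
  have e : avg l - w = (l.length : ℝ)⁻¹ • ((l.map Subtype.val).sum - (l.length : ℝ) • (w : X)) := by
    unfold avg
    rw [smul_sub, smul_smul, inv_mul_cancel₀ hlen.ne', one_smul]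
  rw [dist_eq_norm, e, norm_smul, Real.norm_of_nonneg (by positivity)]
  calc (l.length : ℝ)⁻¹ * _ ≤ (l.length : ℝ)⁻¹ * (((l.length - 1 : ℕ) : ℝ) * D) := by
        gcongr
        exact (key l).trans h2
    _ = _ := by field_simp

lemma subd_small [Inhabited K] {ι : Type} (C : ι → Set X) (hC : ∀ κ, Convex ℝ (C κ))
    (hCK : ∀ κ, C κ ⊆ K) (N : ℕ) {D : ℝ} (hD : 0 ≤ D) (κ : ι) (n : ℕ) (hn : n ≤ N + 1) (l : List K)
    (hl : l.length = n) (hlC : ∀ v ∈ l, (v : X) ∈ C κ) (hlD : ∀ u ∈ l, ∀ v ∈ l, dist u v ≤ D) :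
    subd p bary n (Finsupp.single l 1) ∈ Supp p {l' : List K | l'.length = n ∧
      (∀ B : Set X, Convex ℝ B → (∀ v ∈ l, (v : X) ∈ B) → ∀ v ∈ l', (v : X) ∈ B) ∧
      (∀ u ∈ l', ∀ v ∈ l', dist u v ≤ (N : ℝ) / (N + 1) * D)} := by
  induction n generalizing l with
  | zero =>
    have : l = [] := List.length_eq_zero_iff.1 hl
    subst this
    exact single_mem_Supp (by simp) _
  | succ n ih =>
    rw [subd_single]
    have hne : l ≠ [] := by rintro rfl; simp at hl
    have hb : (bary l : X) = avg l := by
      have : avg l ∈ K := hCK κ (avg_mem (hC κ) l hne hlC)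
      simp [bary, this]
    have hρ : ((l.length - 1 : ℕ) : ℝ) / l.length * D ≤ (N : ℝ) / (N + 1) * D := by
      have h1 : (n : ℝ) ≤ N := by exact_mod_cast (by omega : n ≤ N)
      rw [hl, Nat.add_sub_cancel]
      push_cast
      gcongr ?_ * D
      rw [div_le_div_iff₀ (by positivity) (by positivity)]
      nlinarith
    refine map_mem_Supp (p := p) (s := {l' : List K | l'.length = n ∧
      (∀ B : Set X, Convex ℝ B → (∀ v ∈ l, (v : X) ∈ B) → ∀ v ∈ l', (v : X) ∈ B) ∧
      (∀ u ∈ l', ∀ v ∈ l', dist u v ≤ (N : ℝ) / (N + 1) * D)}) (consL p (bary l)) ?_ ?_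
    · rintro l' ⟨h1, h2, h3⟩
      rw [consL_single]
      have hd : ∀ v ∈ l', dist (bary l) v ≤ (N : ℝ) / (N + 1) * D := by
        intro v hv
        have := h2 (Metric.closedBall (bary l : X) ((N : ℝ) / (N + 1) * D)) (convex_closedBall _ _)
          (fun w hw => by
            rw [Metric.mem_closedBall, dist_comm, hb]
            exact (dist_avg l w hw hlD).trans hρ) v hv
        rw [Metric.mem_closedBall, dist_comm] at this
        exact this
      refine single_mem_Supp ?_ _
      refine ⟨by simp [h1], ?_, ?_⟩
      · intro B hB hlB v hv
        rcases List.mem_cons.1 hv with rfl | hv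
        · rw [hb]; exact avg_mem hB l hne hlB
        · exact h2 B hB hlB v hv
      · intro u hu v hv
        rcases List.mem_cons.1 hu with rfl | hu <;> rcases List.mem_cons.1 hv with rfl | hv
        · rw [dist_self]; positivity
        · exact hd v hv
        · rw [dist_comm]; exact hd u hu
        · exact h3 u hu v hv
    · refine map_mem_Supp (subd p bary n) ?_ (bdList_mem l)
      rintro l'' ⟨h1, h2⟩
      refine Finsupp.supported_mono ?_ (ih (by omega) l'' (by omega)
        (fun v hv => hlC v (h2.subset hv))
        (fun u hu v hv => hlD u (h2.subset hu) v (h2.subset hv)))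
      rintro l' ⟨h3, h4, h5⟩
      exact ⟨h3, fun B hB hlB => h4 B hB (fun v hv => hlB v (h2.subset hv)), h5⟩

/-- Good lists. -/
def Good {ι : Type} (C : ι → Set X) (n : ℕ) (D : ℝ) : Set (List K) :=
  {l | l.length = n ∧ (∃ κ, ∀ v ∈ l, (v : X) ∈ C κ) ∧ ∀ u ∈ l, ∀ v ∈ l, dist u v ≤ D}

/-- Arbitrarily fine systems of chains exist. -/
theorem exists_fine [Inhabited K] {k : ℕ} {ι : Type} (C : ι → Set X) (hC : ∀ κ, Convex ℝ (C κ))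
    (hCK : ∀ κ, C κ ⊆ K) (N : ℕ) (τ : TSys p K k)
    (hb : ∀ i (l : List K), l ≠ [] → bary (l.map (τ.t i)) = τ.t i (bary l))
    {E : (Fin k → ℕ) → Chain p K} (hE : ESys τ N E) {D : ℝ} (hD : 0 ≤ D)
    (hs : ∀ n, ∑ i, n i ≤ N → E n ∈ Supp p (Good C (∑ i, n i + 1) D)) (m : ℕ) :
    ∃ E' : (Fin k → ℕ) → Chain p K, ESys τ N E' ∧
      ∀ n, ∑ i, n i ≤ N → E' n ∈ Supp p (Good C (∑ i, n i + 1) (((N : ℝ) / (N + 1)) ^ m * D)) := by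
  induction m with
  | zero => exact ⟨E, hE, by simpa using hs⟩
  | succ m ih =>
    obtain ⟨E', hE', hs'⟩ := ih
    refine ⟨fun n => subd p bary (∑ i, n i + 1) (E' n), hE'.subd bary hb ?_, ?_⟩
    · intro n hn
      exact Finsupp.supported_mono (fun l hl => hl.1) (hs' n hn)
    · intro n hn
      refine map_mem_Supp _ ?_ (hs' n hn)
      rintro l ⟨h1, ⟨κ, h2⟩, h3⟩
      refine Finsupp.supported_mono ?_ (subd_small C hC hCK N (by positivity) κ _ (by omega) l h1 h2 h3)
      rintro l' ⟨h4, h5, h6⟩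
      refine ⟨h4, ⟨κ, h5 _ (hC κ) h2⟩, ?_⟩
      rw [pow_succ', mul_assoc]
      exact h6

end Metric

end TopTverberg


namespace TopTverberg

open Finset

section Angles

variable {p : ℕ} [Fact p.Prime] {V : Type} {k : ℕ}

/-- Carry. -/
def carry (y : ZMod p) : ℤ := if y.val + 1 = p then 1 else 0

lemma val_add_one_carry (y : ZMod p) : ((y + 1).val : ℤ) = y.val + 1 - p * carry y := by
  have hp : 1 < p := (Fact.out : p.Prime).one_lt
  have : Fact (1 < p) := ⟨hp⟩
  have h := ZMod.val_lt y
  rw [ZMod.val_add, ZMod.val_one]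
  unfold carry
  split_ifs with h1
  · rw [h1, Nat.mod_self]
    have : ((y.val : ℤ) + 1) = p := by exact_mod_cast h1
    rw [this]; simp
  · rw [Nat.mod_eq_of_lt (by omega)]
    push_cast; ring

lemma carry_lt (x y : ZMod p) : (if (y + 1).val < (x + 1).val then (1 : ℤ) else 0)
    = (if y.val < x.val then 1 else 0) + carry y - carry x := by
  have h1 := val_add_one_carry x
  have h2 := val_add_one_carry y
  have h3 := ZMod.val_lt x
  have h4 := ZMod.val_lt y
  have h5 := ZMod.val_lt (x + 1)
  have h6 := ZMod.val_lt (y + 1)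
  unfold carry at *
  generalize (x + 1).val = x' at *
  generalize (y + 1).val = y' at *
  generalize x.val = x'' at *
  generalize y.val = y'' at *
  clear x y
  split_ifs at * <;> simp only [mul_one, mul_zero, sub_zero] at h1 h2 <;> omega

/-- The real approximation to the angle given by the labels. -/
noncomputable def lab (τ : TSys p V k) (χ : Fin k → ZMod p) (v : V) : ℝ :=
  ∑ i, ((χ i).val : ℝ) * ((τ.a i v).val : ℝ) / p

lemma lab_t (τ : TSys p V k) (χ : Fin k → ZMod p) (j : Fin k) (v : V) :
    lab τ χ (τ.t j v) = lab τ χ v + ((χ j).val : ℝ) / p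
      - ((((χ j).val : ℤ) * carry (τ.a j v) : ℤ) : ℝ) := by
  have hp : (p : ℝ) ≠ 0 := by exact_mod_cast (Fact.out : p.Prime).ne_zero
  unfold lab
  have : ∀ i, ((χ i).val : ℝ) * ((τ.a i (τ.t j v)).val : ℝ) / p =
      ((χ i).val : ℝ) * ((τ.a i v).val : ℝ) / p + if i = j then (((χ j).val : ℝ) / p
      - ((((χ j).val : ℤ) * carry (τ.a j v) : ℤ) : ℝ)) else 0 := by
    intro i
    rw [τ.a_t]
    split_ifs with h
    · subst h
      have := val_add_one_carry (τ.a i v)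
      have h2 : (((τ.a i v + 1).val : ℕ) : ℝ) = (τ.a i v).val + 1 - p * carry (τ.a i v) := by
        exact_mod_cast this
      rw [h2]
      push_cast
      field_simp
      ring
    · simp
  rw [Finset.sum_congr rfl fun i _ => this i, Finset.sum_add_distrib, Finset.sum_ite_eq' univ j]
  simp
  ring

/-- Rounded differences. -/
noncomputable def rd (p : ℕ) (B : V → ℝ) (u v : V) : ZMod p := ((-round (B v - B u) : ℤ) : ZMod p)

/-- Cochain data from an equivariant angle function. -/
noncomputable def mkCData (τ : TSys p V k) (χ : Fin k → ZMod p) (B : V → ℝ)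
    (hB : ∀ i v, ∃ n : ℤ, B (τ.t i v) = B v + ((χ i).val : ℝ) / p + n) : CData τ where
  χ := χ
  h := rd p B
  w := fun u v => ((⌊B v - lab τ χ v⌋ : ℤ) : ZMod p) - ((⌊B u - lab τ χ u⌋ : ℤ) : ZMod p)
    + rd p B u v - ∑ i, χ i * al1 τ i u v
  w_inv := by
    intro j u v
    obtain ⟨n, hn⟩ := hB j u
    obtain ⟨m, hm⟩ := hB j v
    have e1 : B (τ.t j u) - lab τ χ (τ.t j u) = (B u - lab τ χ u) +
        ((n + ((χ j).val : ℤ) * carry (τ.a j u) : ℤ) : ℝ) := by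
      rw [hn, lab_t]; push_cast; ring
    have e2 : B (τ.t j v) - lab τ χ (τ.t j v) = (B v - lab τ χ v) +
        ((m + ((χ j).val : ℤ) * carry (τ.a j v) : ℤ) : ℝ) := by
      rw [hm, lab_t]; push_cast; ring
    have e3 : B (τ.t j v) - B (τ.t j u) = (B v - B u) + ((m - n : ℤ) : ℝ) := by
      rw [hn, hm]; push_cast; ring
    have e4 : ∀ i, χ i * al1 τ i (τ.t j u) (τ.t j v) = χ i * al1 τ i u v +
        if i = j then χ j * (((carry (τ.a j v) : ℤ) : ZMod p) - ((carry (τ.a j u) : ℤ) : ZMod p))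
        else 0 := by
      intro i
      unfold al1
      rw [τ.a_t, τ.a_t]
      by_cases h : i = j
      · subst h
        have h2 := congrArg (Int.cast : ℤ → ZMod p) (carry_lt (τ.a i u) (τ.a i v))
        push_cast at h2
        rw [if_pos rfl, if_pos rfl, h2]
        ring
      · simp [h]
    rw [e1, e2, Int.floor_add_intCast, Int.floor_add_intCast, Finset.sum_congr rfl fun i _ => e4 i,
      Finset.sum_add_distrib, Finset.sum_ite_eq' univ j]
    unfold rd
    rw [e3, round_add_intCast]
    push_cast
    rw [ZMod.natCast_zmod_val]
    simp
    ring
  eq := by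
    intro u v x
    simp only [d1, mul_add, mul_sub, Finset.sum_add_distrib, Finset.sum_sub_distrib]
    ring

lemma mkCData_h (τ : TSys p V k) (χ : Fin k → ZMod p) (B : V → ℝ) (hB) :
    (mkCData τ χ B hB).h = rd p B := rfl

lemma mkCData_χ (τ : TSys p V k) (χ : Fin k → ZMod p) (B : V → ℝ) (hB) :
    (mkCData τ χ B hB).χ = χ := rfl

lemma round_near {x : ℝ} {n : ℤ} (h : |x - n| < 1 / 2) : round x = n := by
  rw [round_eq, Int.floor_eq_iff]
  rw [abs_lt] at h
  constructor <;> linarith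

lemma d1_rd_eq_zero (B : V → ℝ) (β : ℝ) (u v w : V) (hu : ∃ n : ℤ, |B u - β - n| < 1 / 4)
    (hv : ∃ n : ℤ, |B v - β - n| < 1 / 4) (hw : ∃ n : ℤ, |B w - β - n| < 1 / 4) :
    d1 (rd p B) u v w = 0 := by
  obtain ⟨a, ha⟩ := hu
  obtain ⟨b, hb⟩ := hv
  obtain ⟨c, hc⟩ := hw
  have key : ∀ (x y : V) (n m : ℤ), |B x - β - n| < 1 / 4 → |B y - β - m| < 1 / 4 →
      round (B y - B x) = m - n := by
    intro x y n m h1 h2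
    apply round_near
    rw [abs_lt] at *
    push_cast
    constructor <;> linarith
  unfold d1 rd
  rw [key v w b c hb hc, key u w a c ha hc, key u v a b ha hb]
  push_cast
  ring

lemma exists_d1_ne {τ : TSys p V k} (cs : List (CData τ)) (l : List V) (h : cupAll cs l ≠ 0)
    (c : CData τ) (hc : c ∈ cs) : ∃ u ∈ l, ∃ v ∈ l, ∃ w ∈ l, d1 c.h u v w ≠ 0 := by
  induction cs generalizing l with
  | nil => simp at hc
  | cons c' cs ih =>
    match l, h with
    | [], h => simp [cupAll, cup2] at h
    | [_], h => simp [cupAll, cup2] at h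
    | [_, _], h => simp [cupAll, cup2] at h
    | u :: v :: w :: l, h =>
      simp only [cupAll, cup2] at h
      rcases List.mem_cons.1 hc with rfl | hc
      · exact ⟨u, by simp, v, by simp, w, by simp, left_ne_zero_of_mul h⟩
      · obtain ⟨a, ha, b, hb, d, hd, h3⟩ := ih (w :: l) (right_ne_zero_of_mul h) hc
        have : ∀ x ∈ w :: l, x ∈ u :: v :: w :: l := fun x hx => by simp at hx ⊢; tauto
        exact ⟨a, this a ha, b, this b hb, d, this d hd, h3⟩

lemma arg_mul_div (x y : ℂ) (hx : x ≠ 0) (hy : y ≠ 0) : ∃ n : ℤ,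
    (x * y).arg / (2 * Real.pi) = x.arg / (2 * Real.pi) + y.arg / (2 * Real.pi) + n := by
  have h := Complex.arg_mul_coe_angle hx hy
  rw [← Real.Angle.coe_add, Real.Angle.angle_eq_iff_two_pi_dvd_sub] at h
  obtain ⟨n, hn⟩ := h
  refine ⟨n, ?_⟩
  have := Real.pi_pos
  field_simp
  linarith

lemma arg_near (z w : ℂ) (η : ℝ) (hw : η ≤ ‖w‖) (h : ‖z - w‖ < η) : ∃ n : ℤ,
    |z.arg / (2 * Real.pi) - w.arg / (2 * Real.pi) - n| < 1 / 4 := by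
  have hη : 0 < η := lt_of_le_of_lt (norm_nonneg _) h
  have hw0 : w ≠ 0 := norm_pos_iff.1 (hη.trans_le hw)
  have h1 : ‖z / w - 1‖ < 1 := by
    have : z / w - 1 = (z - w) / w := by field_simp
    rw [this, norm_div, div_lt_one (by positivity)]
    linarith
  have hre : 0 < (z / w).re := by
    have h2 := (Complex.abs_re_le_norm (z / w - 1)).trans_lt h1
    rw [abs_lt] at h2
    simp only [Complex.sub_re, Complex.one_re] at h2
    linarith
  have hu0 : z / w ≠ 0 := by intro h0; rw [h0] at hre; simp at hre
  obtain ⟨n, hn⟩ := arg_mul_div w (z / w) hw0 hu0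
  rw [mul_div_cancel₀ _ hw0] at hn
  refine ⟨n, ?_⟩
  have h3 : |(z / w).arg| < Real.pi / 2 := Complex.abs_arg_lt_pi_div_two_iff.2 (Or.inl hre)
  have : z.arg / (2 * Real.pi) - w.arg / (2 * Real.pi) - n = (z / w).arg / (2 * Real.pi) := by
    rw [hn]; ring
  have hpi := Real.pi_pos
  rw [this, abs_div, abs_of_pos (by positivity : 0 < 2 * Real.pi), div_lt_iff₀ (by positivity)]
  linarith

lemma arg_char (c : ZMod p) : ∃ n : ℤ,
    (ZMod.stdAddChar c : ℂ).arg / (2 * Real.pi) = (c.val : ℝ) / p + n := by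
  rw [ZMod.stdAddChar_apply, ZMod.toCircle_apply]
  have e : 2 * (Real.pi : ℂ) * Complex.I * c.val / p
      = ((2 * Real.pi * c.val / p : ℝ) : ℂ) * Complex.I := by push_cast; ring
  rw [e]
  rw [Complex.arg_exp_mul_I, toIocMod]
  refine ⟨-toIocDiv Real.two_pi_pos (-Real.pi) (2 * Real.pi * c.val / p), ?_⟩
  have hpi := Real.pi_pos
  have hp : (p : ℝ) ≠ 0 := by exact_mod_cast (Fact.out : p.Prime).ne_zero
  rw [zsmul_eq_mul]
  push_cast
  field_simp
  ring

end Angles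

end TopTverberg


namespace TopTverberg

open Finset

section Concrete

variable {p : ℕ} [Fact p.Prime] {k N : ℕ}

/-- The group. -/
abbrev GG (p k : ℕ) := Fin k → ZMod p

/-- The ambient space. -/
abbrev XX (p k N : ℕ) := Fin (N + 1) → GG p k → ℝ

/-- The simplices of the join. -/
def CC (p k N : ℕ) [Fact p.Prime] (κ : Fin (N + 1) → GG p k) : Set (XX p k N) :=
  {x | (∀ i g, 0 ≤ x i g) ∧ ∑ i, ∑ g, x i g = 1 ∧ ∀ i g, g ≠ κ i → x i g = 0}

/-- The join. -/
def KK (p k N : ℕ) [Fact p.Prime] : Set (XX p k N) := ⋃ κ, CC p k N κ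

lemma CC_sub (κ : Fin (N + 1) → GG p k) : CC p k N κ ⊆ KK p k N :=
  Set.subset_iUnion _ _

lemma CC_convex (κ : Fin (N + 1) → GG p k) : Convex ℝ (CC p k N κ) := by
  rintro x ⟨hx1, hx2, hx3⟩ y ⟨hy1, hy2, hy3⟩ a b ha hb hab
  refine ⟨fun i g => ?_, ?_, fun i g hg => ?_⟩
  · simp only [Pi.add_apply, Pi.smul_apply, smul_eq_mul]
    have := hx1 i g
    have := hy1 i g
    positivity
  · simp only [Pi.add_apply, Pi.smul_apply, smul_eq_mul, Finset.sum_add_distrib, ← Finset.mul_sum]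
    rw [hx2, hy2]; linarith
  · simp [hx3 i g hg, hy3 i g hg]

lemma CC_le_one {κ : Fin (N + 1) → GG p k} {x : XX p k N} (hx : x ∈ CC p k N κ) (i g) : x i g ≤ 1 := by
  rw [← hx.2.1]
  calc x i g ≤ ∑ g, x i g := Finset.single_le_sum (fun g _ => hx.1 i g) (Finset.mem_univ g)
    _ ≤ _ := Finset.single_le_sum (f := fun i => ∑ g, x i g)
      (fun i _ => Finset.sum_nonneg fun g _ => hx.1 i g) (Finset.mem_univ i)

lemma CC_compact (κ : Fin (N + 1) → GG p k) : IsCompact (CC p k N κ) := by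
  have h : IsCompact (Set.Icc (0 : XX p k N) 1) := isCompact_Icc
  refine h.of_isClosed_subset ?_ ?_
  · have e : CC p k N κ = (⋂ i, ⋂ g, {x | 0 ≤ x i g}) ∩ {x | ∑ i, ∑ g, x i g = 1} ∩
      ⋂ i, ⋂ g, ⋂ (_ : g ≠ κ i), {x | x i g = 0} := by
      ext x; simp [CC, and_assoc]
    rw [e]
    refine IsClosed.inter (IsClosed.inter ?_ ?_) ?_
    · exact isClosed_iInter fun i => isClosed_iInter fun g =>
        isClosed_le continuous_const (by fun_prop)
    · exact isClosed_eq (by fun_prop) continuous_const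
    · exact isClosed_iInter fun i => isClosed_iInter fun g => isClosed_iInter fun _ =>
        isClosed_eq (by fun_prop) continuous_const
  · intro x hx
    exact ⟨fun i g => hx.1 i g, fun i g => CC_le_one hx i g⟩

lemma KK_compact : IsCompact (KK p k N) := isCompact_iUnion fun κ => CC_compact κ

/-- Shift. -/
def sh (h : GG p k) (x : XX p k N) : XX p k N := fun i g => x i (g - h)

lemma sh_sh (h h' : GG p k) (x : XX p k N) : sh h (sh h' x) = sh (h + h') x := by
  funext i g
  simp only [sh]
  congr 1
  abel

lemma sh_zero (x : XX p k N) : sh 0 x = x := by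
  funext i g; simp [sh]

lemma sh_mem_CC {κ : Fin (N + 1) → GG p k} {x : XX p k N} (h : GG p k) (hx : x ∈ CC p k N κ) :
    sh h x ∈ CC p k N (fun i => κ i + h) := by
  refine ⟨fun i g => hx.1 i _, ?_, fun i g hg => hx.2.2 i _ ?_⟩
  · rw [← hx.2.1]
    refine Finset.sum_congr rfl fun i _ => ?_
    exact Fintype.sum_equiv (Equiv.subRight h) _ _ (fun g => rfl)
  · intro e
    exact hg (by show g = κ i + h; rw [← e]; abel)

lemma sh_mem (h : GG p k) {x : XX p k N} (hx : x ∈ KK p k N) : sh h x ∈ KK p k N := by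
  obtain ⟨κ, hκ⟩ := Set.mem_iUnion.1 hx
  exact CC_sub _ (sh_mem_CC h hκ)

lemma sh_mem_iff (h : GG p k) {x : XX p k N} : sh h x ∈ KK p k N ↔ x ∈ KK p k N := by
  refine ⟨fun hx => ?_, sh_mem h⟩
  have := sh_mem (-h) hx
  rwa [sh_sh, neg_add_cancel, sh_zero] at this

/-- Shift on the join. -/
def shK (h : GG p k) (x : KK p k N) : KK p k N := ⟨sh h x, sh_mem h x.2⟩

lemma shK_shK (h h' : GG p k) (x : KK p k N) : shK h (shK h' x) = shK (h + h') x :=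
  Subtype.ext (sh_sh _ _ _)

lemma shK_iter (h : GG p k) (n : ℕ) (x : KK p k N) : (shK h)^[n] x = shK (n • h) x := by
  induction n with
  | zero => exact Subtype.ext (by simp [shK, sh_zero])
  | succ n ih => rw [Function.iterate_succ_apply', ih, shK_shK, succ_nsmul']

/-- Leading colour. -/
def IsLead (x : XX p k N) (g : GG p k) : Prop :=
  ∃ i, x i g ≠ 0 ∧ ∀ j < i, ∀ g', x j g' = 0

lemma exists_lead (x : KK p k N) : ∃ g, IsLead (x : XX p k N) g := by
  classical
  obtain ⟨κ, hκ⟩ := Set.mem_iUnion.1 x.2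
  have hne : ∃ i, ∃ g, (x : XX p k N) i g ≠ 0 := by
    by_contra! hcon
    have := hκ.2.1
    simp [hcon] at this
  obtain ⟨g, hg⟩ := (WellFounded.min_mem (wellFounded_lt (α := Fin (N + 1)))
    {i | ∃ g, (x : XX p k N) i g ≠ 0} hne : _)
  refine ⟨g, _, hg, fun j hj g' => ?_⟩
  by_contra h
  exact WellFounded.not_lt_min (wellFounded_lt (α := Fin (N + 1))) _ (x := j) (by exact ⟨g', h⟩) hj

lemma lead_unique (x : KK p k N) {g g' : GG p k} (h : IsLead (x : XX p k N) g)
    (h' : IsLead (x : XX p k N) g') : g = g' := by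
  obtain ⟨κ, hκ⟩ := Set.mem_iUnion.1 x.2
  obtain ⟨i, h1, h2⟩ := h
  obtain ⟨j, h3, h4⟩ := h'
  have e : i = j := by
    rcases lt_trichotomy i j with hl | hl | hl
    · exact absurd (h4 i hl g) h1
    · exact hl
    · exact absurd (h2 j hl g') h3
  subst e
  have a1 : g = κ i := by by_contra hc; exact h1 (hκ.2.2 i g hc)
  have a2 : g' = κ i := by by_contra hc; exact h3 (hκ.2.2 i g' hc)
  rw [a1, a2]

noncomputable def lead (x : KK p k N) : GG p k := (exists_lead x).choose

lemma lead_sh (h : GG p k) (x : KK p k N) : lead (shK h x) = lead x + h := by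
  refine lead_unique (shK h x) (exists_lead _).choose_spec ?_
  obtain ⟨i, h1, h2⟩ := (exists_lead x).choose_spec
  refine ⟨i, ?_, fun j hj g' => h2 j hj _⟩
  simpa [shK, sh, lead] using h1

/-- The system. -/
noncomputable def tau (p k N : ℕ) [Fact p.Prime] : TSys p (KK p k N) k where
  t := fun i => shK (Pi.single i 1)
  comm := by intro i j v; rw [shK_shK, shK_shK, add_comm]
  pow := by
    intro i v
    rw [shK_iter]
    have : p • (Pi.single i 1 : GG p k) = 0 := by
      funext j; simp
    rw [this]
    exact Subtype.ext (sh_zero _)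
  a := fun i v => lead v i
  a_t := by
    intro i j v
    rw [lead_sh, Pi.add_apply, Pi.single_apply]

lemma tau_t (i : Fin k) : (tau p k N).t i = shK (Pi.single i 1) := rfl

/-- Vertices. -/
noncomputable def vtx (j : ℕ) (g : GG p k) : XX p k N :=
  fun i g' => if i = Fin.ofNat (N + 1) j ∧ g' = g then 1 else 0

lemma vtx_mem_CC (j : ℕ) (g : GG p k) (κ : Fin (N + 1) → GG p k) (h : κ (Fin.ofNat (N + 1) j) = g) :
    (vtx j g : XX p k N) ∈ CC p k N κ := by
  refine ⟨fun i g' => ?_, ?_, fun i g' hg => ?_⟩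
  · unfold vtx; split_ifs <;> norm_num
  · simp [vtx, ite_and]
  · unfold vtx
    rw [if_neg]
    rintro ⟨rfl, rfl⟩
    exact hg h.symm

noncomputable def vtxK (p k N : ℕ) [Fact p.Prime] (j : ℕ) (g : GG p k) : KK p k N :=
  ⟨vtx j g, CC_sub _ (vtx_mem_CC j g (fun _ => g) rfl)⟩

lemma sh_vtx (h : GG p k) (j : ℕ) (g : GG p k) : shK h (vtxK p k N j g) = vtxK p k N j (g + h) := by
  apply Subtype.ext
  funext i g'
  simp only [shK, sh, vtxK, vtx, sub_eq_iff_eq_add]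

noncomputable instance : Inhabited (KK p k N) := ⟨vtxK p k N 0 0⟩

lemma avg_sh (h : GG p k) (l : List (KK p k N)) : avg (l.map (shK h)) = sh h (avg l) := by
  unfold avg
  rw [List.length_map]
  funext i g
  simp only [sh, Pi.smul_apply]
  congr 1
  induction l with
  | nil => simp
  | cons v l ih => simpa [shK, sh] using ih

lemma bary_sh (h : GG p k) (l : List (KK p k N)) (hl : l ≠ []) :
    bary (l.map (shK h)) = shK h (bary l) := by
  unfold bary
  by_cases hm : avg l ∈ KK p k N
  · have h2 : avg (l.map (shK h)) ∈ KK p k N := by rw [avg_sh]; exact sh_mem h hm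
    rw [dif_pos hm, dif_pos h2]
    exact Subtype.ext (avg_sh h l)
  · have h2 : avg (l.map (shK h)) ∉ KK p k N := by rw [avg_sh, sh_mem_iff]; exact hm
    rw [dif_neg hm, dif_neg h2]
    cases l with
    | nil => exact absurd rfl hl
    | cons v l => rfl

/-- Vertex lists. -/
def LL (p k N : ℕ) [Fact p.Prime] (m : ℕ) : Set (List (KK p k N)) :=
  {l | l.length = m + 1 ∧ ∃ κ : ℕ → GG p k, ∀ v ∈ l, ∃ j ≤ m, v = vtxK p k N j (κ j)}

lemma act_LL (m : ℕ) (i : Fin k) {z : Chain p (KK p k N)} (hz : z ∈ Supp p (LL p k N m)) :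
    act p ((tau p k N).t i) z ∈ Supp p (LL p k N m) := by
  refine map_mem_Supp (act p ((tau p k N).t i)) ?_ hz
  rintro l ⟨h1, κ, h2⟩
  rw [act_single]
  refine single_mem_Supp ?_ _
  refine ⟨by simpa using h1, fun j => κ j + Pi.single i 1, ?_⟩
  intro v hv
  obtain ⟨u, hu, rfl⟩ := List.mem_map.1 hv
  obtain ⟨j, hj, rfl⟩ := h2 u hu
  exact ⟨j, hj, by rw [tau_t, sh_vtx]⟩

lemma pow_LL (m s : ℕ) (i : Fin k) {z : Chain p (KK p k N)} (hz : z ∈ Supp p (LL p k N m)) :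
    (act p ((tau p k N).t i) ^ s) z ∈ Supp p (LL p k N m) := by
  induction s with
  | zero => simpa using hz
  | succ s ih => rw [pow_succ', Module.End.mul_apply]; exact act_LL m i ih

lemma DD_LL (m n : ℕ) (i : Fin k) {z : Chain p (KK p k N)} (hz : z ∈ Supp p (LL p k N m)) :
    DD p ((tau p k N).t i) n z ∈ Supp p (LL p k N m) := by
  unfold DD
  split_ifs
  · simp
  · rw [LinearMap.sum_apply]
    exact Submodule.sum_mem _ fun s _ => pow_LL m s i hz
  · exact Submodule.sub_mem _ (act_LL m i hz) hz

lemma Erec_LL (m : ℕ) (n : Fin k → ℕ) :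
    Erec (tau p k N) (fun j => vtxK p k N j 0) m n ∈ Supp p (LL p k N m) := by
  induction m generalizing n with
  | zero =>
    refine single_mem_Supp ?_ _
    exact ⟨rfl, 0, by simp⟩
  | succ m ih =>
    refine map_mem_Supp (s := LL p k N m) (consL p (vtxK p k N (m + 1) 0)) ?_ ?_
    · rintro l ⟨h1, κ, h2⟩
      rw [consL_single]
      refine single_mem_Supp ?_ _
      refine ⟨by simpa using h1, fun j => if j = m + 1 then 0 else κ j, ?_⟩
      intro v hv
      rcases List.mem_cons.1 hv with rfl | hv
      · exact ⟨m + 1, le_rfl, by simp⟩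
      · obtain ⟨j, hj, rfl⟩ := h2 v hv
        refine ⟨j, by omega, ?_⟩
        have : j ≠ m + 1 := by omega
        simp [this]
    · exact Submodule.sum_mem _ fun i _ => Submodule.smul_mem _ _ (DD_LL m _ i (ih _))

lemma EE_good (n : Fin k → ℕ) (hn : ∑ i, n i ≤ N) :
    EE (tau p k N) (fun j => vtxK p k N j 0) n ∈ Supp p (Good (CC p k N) (∑ i, n i + 1) 1) := by
  refine Finsupp.supported_mono ?_ (Erec_LL (∑ i, n i) n)
  rintro l ⟨h1, κ, h2⟩
  have h3 : ∀ v ∈ l, (v : XX p k N) ∈ CC p k N (fun i => κ i) := by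
    intro v hv
    obtain ⟨j, hj, rfl⟩ := h2 v hv
    refine vtx_mem_CC j _ _ ?_
    simp only [Fin.ofNat]
    rw [Nat.mod_eq_of_lt (by omega)]
  refine ⟨h1, ⟨_, h3⟩, ?_⟩
  intro u hu v hv
  rw [Subtype.dist_eq]
  refine (dist_pi_le_iff zero_le_one).2 fun i => (dist_pi_le_iff zero_le_one).2 fun g => ?_
  exact Real.dist_le_of_mem_Icc_01 ⟨(h3 u hu).1 i g, CC_le_one (h3 u hu) i g⟩
    ⟨(h3 v hv).1 i g, CC_le_one (h3 v hv) i g⟩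

end Concrete

end TopTverberg


namespace TopTverberg

open Finset

section Core

variable {p : ℕ} [Fact p.Prime] {k N D : ℕ}

/-- Fourier coefficient. -/
noncomputable def four (ψ : GG p k → ℂ) (χ : GG p k) : ℂ :=
  ∑ g, ZMod.stdAddChar (∑ i, χ i * g i) * ψ g

lemma four_shift (ψ : GG p k → ℂ) (χ : GG p k) (j : Fin k) :
    four (fun g => ψ (g - Pi.single j 1)) χ = ZMod.stdAddChar (χ j) * four ψ χ := by
  unfold four
  rw [Finset.mul_sum]
  refine Fintype.sum_equiv (Equiv.subRight (Pi.single j 1)) _ _ fun g => ?_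
  simp only [Equiv.subRight_apply]
  rw [← mul_assoc, ← AddChar.map_add_eq_mul]
  congr 2
  simp [mul_sub, Finset.sum_sub_distrib, Pi.single_apply]

lemma sum_char (d : GG p k) : ∑ χ : GG p k, (ZMod.stdAddChar (∑ i, χ i * d i) : ℂ)
    = if d = 0 then (p : ℂ) ^ k else 0 := by
  classical
  have e : ∀ χ : GG p k, (ZMod.stdAddChar (∑ i, χ i * d i) : ℂ)
      = ∏ i, (ZMod.stdAddChar (χ i * d i) : ℂ) := by
    intro χ
    have : ∀ s : Finset (Fin k), (ZMod.stdAddChar (∑ i ∈ s, χ i * d i) : ℂ)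
        = ∏ i ∈ s, (ZMod.stdAddChar (χ i * d i) : ℂ) := by
      intro s
      induction s using Finset.induction_on with
      | empty => simp
      | insert a s ha ih =>
        rw [Finset.sum_insert ha, Finset.prod_insert ha, AddChar.map_add_eq_mul, ih]
    exact this _
  simp_rw [e]
  rw [← Fintype.prod_sum (fun i (c : ZMod p) => (ZMod.stdAddChar (c * d i) : ℂ))]
  simp_rw [AddChar.sum_mulShift _ (ZMod.isPrimitive_stdAddChar p)]
  split_ifs with h
  · subst h; simp
  · obtain ⟨i, hi⟩ : ∃ i, d i ≠ 0 := by
      by_contra! hc; exact h (funext hc)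
    exact Finset.prod_eq_zero (Finset.mem_univ i) (by simp [hi])

lemma four_inv (ψ : GG p k → ℂ) (h : ∀ χ, χ ≠ 0 → four ψ χ = 0) (g : GG p k) :
    (p : ℂ) ^ k * ψ g = four ψ 0 := by
  classical
  have e1 : ∑ χ : GG p k, ZMod.stdAddChar (∑ i, χ i * (-g) i) * four ψ χ = four ψ 0 := by
    rw [Finset.sum_eq_single 0]
    · simp
    · intro χ _ hχ; rw [h χ hχ, mul_zero]
    · simp
  rw [← e1]
  unfold four
  simp_rw [Finset.mul_sum, ← mul_assoc, ← AddChar.map_add_eq_mul, ← Finset.sum_add_distrib, ← mul_add]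
  rw [Finset.sum_comm]
  simp_rw [← Finset.sum_mul]
  have : ∀ g' : GG p k, ∑ χ : GG p k, (ZMod.stdAddChar (∑ i, χ i * ((-g) i + g' i)) : ℂ)
      = if -g + g' = 0 then (p : ℂ) ^ k else 0 := fun g' => sum_char (-g + g')
  simp_rw [this]
  have h2 : ∀ g' : GG p k, (-g + g' = 0) ↔ g' = g := by
    intro g'; rw [neg_add_eq_zero, eq_comm]
  simp [h2]

theorem core (p k D N : ℕ) [Fact p.Prime] (hN : N = 2 * ((p ^ k - 1) * D))
    (φ : (Fin (N + 1) → ℝ) → Fin D → ℂ) (hφ : Continuous φ) :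
    ∃ x ∈ KK p k N, ∀ g g' : GG p k,
      φ (fun i => x i g) = φ (fun i => x i g') := by
  classical
  let J := {χ : GG p k // χ ≠ 0} × Fin D
  have hJ : Fintype.card J = (p ^ k - 1) * D := by
    rw [Fintype.card_prod, Fintype.card_fin, Fintype.card_subtype_compl]
    simp [ZMod.card]
  let F : J → XX p k N → ℂ := fun c x => four (fun g => φ (fun i => x i g) c.2) c.1.1
  have hFc : ∀ c, Continuous (F c) := by
    intro c
    refine continuous_finsetSum _ fun g _ => continuous_const.mul ?_
    have h1 : Continuous (fun x : XX p k N => fun i => x i g) := by fun_prop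
    exact (continuous_apply c.2).comp (hφ.comp h1)
  by_cases hz : ∃ x ∈ KK p k N, ∀ c, F c x = 0
  · obtain ⟨x, hx, h0⟩ := hz
    refine ⟨x, hx, fun g g' => funext fun l => ?_⟩
    have h1 := four_inv (fun g => φ (fun i => x i g) l) (fun χ hχ => h0 (⟨χ, hχ⟩, l))
    have hp : (p : ℂ) ^ k ≠ 0 := pow_ne_zero _ (by exact_mod_cast (Fact.out : p.Prime).ne_zero)
    exact mul_left_cancel₀ hp ((h1 g).trans (h1 g').symm)
  exfalso
  push Not at hz
  have hlow : ∃ η > 0, ∀ x ∈ KK p k N, ∃ c, η ≤ ‖F c x‖ := by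
    let S : XX p k N → ℝ := fun x => ∑ c, ‖F c x‖
    have hS : ContinuousOn S (KK p k N) :=
      (continuous_finsetSum _ fun c _ => (hFc c).norm).continuousOn
    have hne : (KK p k N).Nonempty := ⟨_, (default : KK p k N).2⟩
    obtain ⟨x0, hx0, hmin⟩ := KK_compact.exists_isMinOn hne hS
    have hpos : 0 < S x0 := by
      obtain ⟨c, hc⟩ := hz x0 hx0
      exact Finset.sum_pos' (fun _ _ => norm_nonneg _) ⟨c, Finset.mem_univ _, norm_pos_iff.2 hc⟩
    have hJ0 : (0 : ℝ) < Fintype.card J := by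
      obtain ⟨c, hc⟩ := hz x0 hx0
      have : Nonempty J := ⟨c⟩
      exact_mod_cast Fintype.card_pos
    refine ⟨S x0 / Fintype.card J, by positivity, fun x hx => ?_⟩
    by_contra! hcon
    have h1 : S x0 ≤ S x := hmin hx
    have h2 : S x < ∑ _c : J, S x0 / Fintype.card J := by
      obtain ⟨c, hc⟩ := hz x hx
      exact Finset.sum_lt_sum_of_nonempty ⟨c, Finset.mem_univ _⟩ fun c _ => hcon c
    rw [Finset.sum_const, Finset.card_univ, nsmul_eq_mul, mul_div_cancel₀ _ hJ0.ne'] at h2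
    linarith
  obtain ⟨η, hη, hlow⟩ := hlow
  have huc : ∃ δ > 0, ∀ c, ∀ x ∈ KK p k N, ∀ y ∈ KK p k N, dist x y < δ → ‖F c x - F c y‖ < η := by
    have h1 : UniformContinuousOn (fun x c => F c x) (KK p k N) :=
      KK_compact.uniformContinuousOn_of_continuous (continuous_pi hFc).continuousOn
    obtain ⟨δ, hδ, h2⟩ := Metric.uniformContinuousOn_iff.1 h1 η hη
    refine ⟨δ, hδ, fun c x hx y hy hxy => ?_⟩
    have h3 := h2 x hx y hy hxy
    rw [dist_pi_lt_iff hη] at h3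
    rw [← dist_eq_norm]
    exact h3 c
  obtain ⟨δ, hδ, huc⟩ := huc
  let τ := tau p k N
  let B : J → KK p k N → ℝ := fun c v =>
    if F c v = 0 then lab τ c.1.1 v else (F c v).arg / (2 * Real.pi)
  have hFt : ∀ c i v, F c (τ.t i v) = ZMod.stdAddChar (c.1.1 i) * F c v := by
    intro c i v
    exact four_shift (fun g => φ (fun i => (v : XX p k N) i g) c.2) c.1.1 i
  have hB : ∀ c i v, ∃ n : ℤ, B c (τ.t i v) = B c v + ((c.1.1 i).val : ℝ) / p + n := by
    intro c i v
    have hne : (ZMod.stdAddChar (c.1.1 i) : ℂ) ≠ 0 := by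
      rw [ZMod.stdAddChar_apply, ZMod.toCircle_apply]; exact Complex.exp_ne_zero _
    simp only [B]
    by_cases h0 : F c v = 0
    · rw [if_pos h0, if_pos (by rw [hFt, h0, mul_zero]), lab_t]
      exact ⟨-(((c.1.1 i).val : ℤ) * carry (τ.a i v)), by push_cast; ring⟩
    · have h1 : F c (τ.t i v) ≠ 0 := by rw [hFt]; exact mul_ne_zero hne h0
      rw [if_neg h0, if_neg h1, hFt]
      obtain ⟨n, hn⟩ := arg_mul_div _ _ hne h0
      obtain ⟨m, hm⟩ := arg_char (c.1.1 i)
      refine ⟨n + m, ?_⟩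
      rw [hn, hm]
      push_cast; ring
  let cs : List (CData τ) := (Finset.univ : Finset J).toList.map
    (fun c => mkCData τ c.1.1 (B c) (hB c))
  have hcs : ∀ c ∈ cs, c.χ ≠ 0 := by
    intro c hc
    obtain ⟨j, _, rfl⟩ := List.mem_map.1 hc
    exact j.1.2
  have hlen : 2 * cs.length = N := by
    simp only [cs, List.length_map, Finset.length_toList, Finset.card_univ]
    rw [hJ, hN]
  obtain ⟨m, hm⟩ : ∃ m : ℕ, ((N : ℝ) / (N + 1)) ^ m < δ :=
    exists_pow_lt_of_lt_one hδ (by rw [div_lt_one (by positivity)]; linarith)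
  obtain ⟨E, hE, hs⟩ := exists_fine (CC p k N) CC_convex CC_sub N τ
    (fun i l hl => bary_sh _ l hl) (EE_sys τ (fun j => vtxK p k N j 0) N) zero_le_one
    (fun n hn => EE_good n hn) m
  obtain ⟨n, hn, hev⟩ := exists_ne_zero τ hE cs hcs hlen.le
  have hs' := hs n (by rw [hn, hlen])
  obtain ⟨l, hl, hne⟩ : ∃ l ∈ Good (CC p k N) (∑ i, n i + 1) (((N : ℝ) / (N + 1)) ^ m * 1),
      cupAll cs l ≠ 0 := by
    by_contra! hcon
    apply hev
    have := map_mem_Supp (M := (⊥ : Submodule (ZMod p) (ZMod p))) (ev (cupAll cs))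
      (fun l hl => by rw [ev_single, hcon l hl, mul_zero]; exact Submodule.zero_mem _) hs'
    exact (Submodule.mem_bot _).1 this
  obtain ⟨hl1, -, hl3⟩ := hl
  obtain ⟨v0, hv0⟩ : ∃ v, v ∈ l := List.exists_mem_of_length_pos (by omega)
  obtain ⟨c, hc⟩ := hlow v0 v0.2
  obtain ⟨u, hu, v, hv, w, hw, hd⟩ := exists_d1_ne cs l hne (mkCData τ c.1.1 (B c) (hB c))
    (List.mem_map.2 ⟨c, by simp, rfl⟩)
  apply hd
  rw [mkCData_h]
  have key : ∀ x ∈ l, ∃ n : ℤ, |B c x - (F c v0).arg / (2 * Real.pi) - n| < 1 / 4 := by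
    intro x hx
    have h1 : ‖F c x - F c v0‖ < η := by
      refine huc c x x.2 v0 v0.2 (lt_of_le_of_lt (hl3 x hx v0 hv0) ?_)
      rwa [mul_one]
    have h2 : F c x ≠ 0 := by
      intro h0
      rw [h0, zero_sub, norm_neg] at h1
      linarith
    simp only [B]
    rw [if_neg h2]
    exact arg_near _ _ η hc h1
  exact d1_rd_eq_zero (B c) _ u v w (key u hu) (key v hv) (key w hw)

end Core

end TopTverberg


namespace TopTverberg

open Finset

section Final

lemma cone_continuous {n : ℕ} (g : (Fin n → ℝ) → ℝ) (hg : Continuous g) :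
    Continuous (fun y : Fin n → ℝ => (∑ i, |y i|) * g (fun i => |y i| / ∑ j, |y j|)) := by
  obtain ⟨M, hM⟩ := (isCompact_Icc (a := (0 : Fin n → ℝ)) (b := 1)).exists_bound_of_continuousOn
    hg.continuousOn
  have hs : Continuous (fun y : Fin n → ℝ => ∑ i, |y i|) := by fun_prop
  rw [continuous_iff_continuousAt]
  intro y0
  by_cases h0 : ∑ i, |y0 i| = 0
  · unfold ContinuousAt
    simp only [h0, zero_mul]
    have hlim : Filter.Tendsto (fun y : Fin n → ℝ => M * ∑ i, |y i|) (nhds y0) (nhds 0) := by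
      have := (continuous_const.mul hs).tendsto (f := fun y : Fin n → ℝ => M * ∑ i, |y i|) y0
      simpa [h0] using this
    refine squeeze_zero_norm (fun y => ?_) hlim
    have hnn : 0 ≤ ∑ i, |y i| := Finset.sum_nonneg fun i _ => abs_nonneg _
    rw [norm_mul, Real.norm_of_nonneg hnn, mul_comm]
    refine mul_le_mul_of_nonneg_right (hM _ ⟨fun i => ?_, fun i => ?_⟩) hnn
    · exact div_nonneg (abs_nonneg _) hnn
    · exact div_le_one_of_le₀ (Finset.single_le_sum (f := fun i => |y i|)
        (fun i _ => abs_nonneg _) (Finset.mem_univ i)) hnn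
  · refine hs.continuousAt.mul (hg.continuousAt.comp ?_)
    refine continuousAt_pi.2 fun i => ?_
    refine ContinuousAt.div ?_ hs.continuousAt h0
    exact (continuous_abs.comp (continuous_apply i)).continuousAt

theorem main (d p k n N : ℕ) [Fact p.Prime] (hn : n = (d + 1) * (p ^ k - 1) + 1)
    (hN : N = 2 * ((p ^ k - 1) * (d + 1)))
    (f : C(stdSimplex ℝ (Fin n), Fin d → ℝ)) :
    ∃ x : GG p k → stdSimplex ℝ (Fin n), (∀ g g', g ≠ g' → ∀ i, (x g : Fin n → ℝ) i ≠ 0 →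
      (x g' : Fin n → ℝ) i = 0) ∧ ∀ g g', f (x g) = f (x g') := by
  classical
  obtain ⟨F, hF⟩ := ContinuousMap.exists_restrict_eq (isClosed_stdSimplex ℝ (Fin n)) f
  have hpk : 0 < p ^ k := pow_pos (Fact.out : p.Prime).pos k
  have hcardG : Fintype.card (GG p k) = p ^ k := by simp [ZMod.card]
  have hcard : Fintype.card (Fin n ⊕ (Fin (d + 1) × Fin (p ^ k - 1))) = N + 1 := by
    simp only [Fintype.card_sum, Fintype.card_prod, Fintype.card_fin]
    rw [hn, hN]; ring
  let e : (Fin n ⊕ (Fin (d + 1) × Fin (p ^ k - 1))) ≃ Fin (N + 1) := Fintype.equivFinOfCardEq hcard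
  let Y : (Fin (N + 1) → ℝ) → Fin n → ℝ := fun u i => u (e (Sum.inl i))
  have hY : Continuous Y := by fun_prop
  let R : (Fin n → ℝ) → Fin (d + 1) → ℝ := fun y => Fin.cons (∑ i, |y i|)
    (fun j => (∑ i, |y i|) * F (fun i => |y i| / ∑ j, |y j|) j)
  have hR : Continuous R := by
    refine continuous_pi fun b => ?_
    refine Fin.cases ?_ (fun j => ?_) b
    · simp only [R, Fin.cons_zero]; fun_prop
    · simp only [R, Fin.cons_succ]
      exact cone_continuous (fun y => F y j) ((continuous_apply j).comp F.continuous)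
  let Z : (Fin (N + 1) → ℝ) → Fin (d + 1) → ℝ := fun u b => ∑ s, u (e (Sum.inr (b, s)))
  have hZ : Continuous Z := by fun_prop
  let φ : (Fin (N + 1) → ℝ) → Fin (d + 1) → ℂ := fun u b => ⟨R (Y u) b, Z u b⟩
  have hφ : Continuous φ := by
    refine continuous_pi fun b => ?_
    have h1 : Continuous (fun u => R (Y u) b) := (continuous_apply b).comp (hR.comp hY)
    have h2 : Continuous (fun u => Z u b) := (continuous_apply b).comp hZ
    exact Complex.equivRealProdCLM.symm.continuous.comp (h1.prodMk h2)
  obtain ⟨x, hx, heq⟩ := core p k (d + 1) N hN φ hφ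
  obtain ⟨κ, hκ⟩ := Set.mem_iUnion.1 hx
  have hRe : ∀ g g' b, R (Y fun i => x i g) b = R (Y fun i => x i g') b := fun g g' b =>
    congrArg Complex.re (congrFun (heq g g') b)
  have hIm : ∀ g g' b, Z (fun i => x i g) b = Z (fun i => x i g') b := fun g g' b =>
    congrArg Complex.im (congrFun (heq g g') b)
  have hz : ∀ b s g, x (e (Sum.inr (b, s))) g = 0 := by
    intro b
    obtain ⟨g0, hg0⟩ : ∃ g0, ∀ s, κ (e (Sum.inr (b, s))) ≠ g0 := by
      by_contra! hcon
      have : Function.Surjective (fun s : Fin (p ^ k - 1) => κ (e (Sum.inr (b, s)))) := hcon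
      have h1 := Fintype.card_le_of_surjective _ this
      rw [hcardG, Fintype.card_fin] at h1
      omega
    have h0 : Z (fun i => x i g0) b = 0 :=
      Finset.sum_eq_zero fun s _ => hκ.2.2 _ _ (hg0 s).symm
    intro s g
    have h1 : ∑ s, x (e (Sum.inr (b, s))) g = 0 := (hIm g g0 b).trans h0
    exact (Finset.sum_eq_zero_iff_of_nonneg (fun s _ => hκ.1 _ _)).1 h1 s (Finset.mem_univ s)
  have habs : ∀ g i, |Y (fun i => x i g) i| = x (e (Sum.inl i)) g := fun g i =>
    abs_of_nonneg (hκ.1 _ _)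
  have hw : ∀ g g', ∑ i, x (e (Sum.inl i)) g = ∑ i, x (e (Sum.inl i)) g' := by
    intro g g'
    have := hRe g g' 0
    simp only [R, Fin.cons_zero, habs] at this
    exact this
  have htot : ∑ g, ∑ i, x (e (Sum.inl i)) g = 1 := by
    rw [← hκ.2.1, Finset.sum_comm, ← e.sum_comp, Fintype.sum_sum_type]
    have : ∑ q : Fin (d + 1) × Fin (p ^ k - 1), ∑ g, x (e (Sum.inr q)) g = 0 :=
      Finset.sum_eq_zero fun q _ => Finset.sum_eq_zero fun g _ => hz q.1 q.2 g
    rw [this, add_zero]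
  have hpos : ∀ g, 0 < ∑ i, x (e (Sum.inl i)) g := by
    intro g
    refine lt_of_le_of_ne (Finset.sum_nonneg fun i _ => hκ.1 _ _) fun h => ?_
    rw [Finset.sum_congr rfl fun g' _ => (hw g' g).trans h.symm] at htot
    simp at htot
  refine ⟨fun g => ⟨fun i => x (e (Sum.inl i)) g / ∑ j, x (e (Sum.inl j)) g, ?_, ?_⟩, ?_, ?_⟩
  · exact fun i => div_nonneg (hκ.1 _ _) (hpos g).le
  · rw [← Finset.sum_div, div_self (hpos g).ne']
  · intro g g' hne i hi
    have h1 : x (e (Sum.inl i)) g ≠ 0 := by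
      intro h0; apply hi
      show x (e (Sum.inl i)) g / _ = 0
      rw [h0, zero_div]
    have h2 : g = κ (e (Sum.inl i)) := by
      by_contra hc; exact h1 (hκ.2.2 _ _ hc)
    have h3 : x (e (Sum.inl i)) g' = 0 := hκ.2.2 _ _ (fun h => hne (h2.trans h.symm))
    show x (e (Sum.inl i)) g' / _ = 0
    rw [h3, zero_div]
  · intro g g'
    have hfF : ∀ z : stdSimplex ℝ (Fin n), f z = F z := by
      intro z; rw [← hF]; rfl
    rw [hfF, hfF]
    funext j
    have h1 := hRe g g' j.succ
    simp only [R, Fin.cons_succ, habs] at h1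
    rw [hw g' g] at h1
    have h2 := mul_left_cancel₀ (hpos g).ne' h1
    show F (fun i => x (e (Sum.inl i)) g / ∑ j, x (e (Sum.inl j)) g) j
      = F (fun i => x (e (Sum.inl i)) g' / ∑ j, x (e (Sum.inl j)) g') j
    rw [hw g' g]
    exact h2

end Final

end TopTverberg

theorem topological_tverberg (d r : ℕ) (hd : 1 ≤ d) (hr : IsPrimePow r)
    (f : C(↥(stdSimplex ℝ (Fin ((d + 1) * (r - 1) + 1))), Fin d → ℝ)) :
    ∃ S : Fin r → Set (Fin ((d + 1) * (r - 1) + 1)),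
      (∀ j, (S j).Nonempty) ∧
      (∀ j l, j ≠ l → Disjoint (S j) (S l)) ∧
      (⋂ j, f '' {x : ↥(stdSimplex ℝ (Fin ((d + 1) * (r - 1) + 1))) |
        ∀ i, i ∉ S j → (x : Fin ((d + 1) * (r - 1) + 1) → ℝ) i = 0}).Nonempty := by
  obtain ⟨p, k, hp, hk, hpk⟩ := (isPrimePow_nat_iff r).1 hr
  have hfact : Fact p.Prime := ⟨hp⟩
  obtain ⟨x, hx1, hx2⟩ := TopTverberg.main d p k ((d + 1) * (r - 1) + 1) _ (by rw [hpk]) rfl f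
  have hcard : Fintype.card (TopTverberg.GG p k) = r := by rw [← hpk]; simp [ZMod.card]
  let e : TopTverberg.GG p k ≃ Fin r := Fintype.equivFinOfCardEq hcard
  refine ⟨fun j => {i | (x (e.symm j) : Fin ((d + 1) * (r - 1) + 1) → ℝ) i ≠ 0}, ?_, ?_, ?_⟩
  · intro j
    by_contra hcon
    rw [Set.not_nonempty_iff_eq_empty, Set.eq_empty_iff_forall_notMem] at hcon
    have h1 : ∀ i, (x (e.symm j) : Fin ((d + 1) * (r - 1) + 1) → ℝ) i = 0 := by
      intro i
      by_contra h
      exact hcon i h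
    have h2 := (x (e.symm j)).2.2
    exact zero_ne_one ((Finset.sum_eq_zero fun i _ => h1 i).symm.trans h2)
  · intro j l hjl
    rw [Set.disjoint_left]
    intro i hi hi'
    exact hi' (hx1 _ _ (fun h => hjl (e.symm.injective h)) i hi)
  · refine ⟨f (x 0), Set.mem_iInter.2 fun j => ⟨x (e.symm j), ?_, hx2 _ _⟩⟩
    intro i hi
    by_contra h
    exact hi h
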